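/- arXiv:math/0401382 — 2 statements merged into one kernel-verified Lean document; each statement's English description precedes it below -/
import Mathlib

section
/- For every n ≥ 2 and all real x: G_2(x;n) := P_n(x) P_{n−1}(x)(x − α) − Q_n(x) Q_{n−1}(x)(x² − 1)(x − β) satisfies G_2(x;n) = h_{n−1} · ( x² − ((α + β)/2) x + 2 a_n − (α − β)²/8 − 1/2 ). -/
open MeasureTheory Polynomial

open Complex in
theorem norm_eq_one_of_quadratic {c : ℝ} (h1 : -1 < c) (h2 : c < 1) {ζ : ℂ}
    (h : ζ ^ 2 - 2 * c * ζ + 1 = 0) : ‖ζ‖ = 1 := by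
  have hre := congrArg Complex.re h
  have him := congrArg Complex.im h
  simp [pow_two] at hre him
  have hy : ζ.im * (ζ.re - c) = 0 := by linarith
  have : ζ.re * ζ.re + ζ.im * ζ.im = 1 := by
    rcases mul_eq_zero.1 hy with hy | hy
    · rw [hy] at hre
      nlinarith [sq_nonneg (ζ.re - c)]
    · have : ζ.re = c := by linarith
      rw [this] at hre ⊢
      nlinarith
  rw [Complex.norm_def, Complex.normSq_apply, this, Real.sqrt_one]

theorem quadratic_ratio_mem_slitPlane {α β : ℝ} (hα : -1 < α) (hαβ : α < β) (hβ : β < 1) {ζ : ℂ}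
    (hζ : ‖ζ‖ < 1) :
    (ζ ^ 2 - 2 * α * ζ + 1) / (ζ ^ 2 - 2 * β * ζ + 1) ∈ Complex.slitPlane := by
  have hd : ζ ^ 2 - 2 * β * ζ + 1 ≠ 0 := fun h =>
    hζ.ne (norm_eq_one_of_quadratic (by linarith) hβ h)
  rw [Complex.mem_slitPlane_iff_not_le_zero]
  intro hle
  obtain ⟨hre, him⟩ := Complex.le_def.1 hle
  set t : ℝ := ((ζ ^ 2 - 2 * α * ζ + 1) / (ζ ^ 2 - 2 * β * ζ + 1)).re with ht
  have hq : (ζ ^ 2 - 2 * α * ζ + 1) / (ζ ^ 2 - 2 * β * ζ + 1) = (t : ℂ) :=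
    Complex.ext (by simp [ht]) (by simpa using him)
  rw [div_eq_iff hd] at hq
  have ht0 : t ≤ 0 := by simpa using hre
  have h1t : (1 : ℝ) - t ≠ 0 := by linarith
  have h1t' : (1 : ℂ) - t ≠ 0 := by exact_mod_cast h1t
  refine hζ.ne (norm_eq_one_of_quadratic (c := (α - t * β) / (1 - t)) ?_ ?_ ?_)
  · rw [lt_div_iff₀ (by linarith)]; nlinarith
  · rw [div_lt_iff₀ (by linarith)]; nlinarith
  · push_cast
    field_simp
    linear_combination hq

theorem norm_sub_le_two_mul {u b : ℂ} (hu : ‖u‖ = 1) (hb : ‖b‖ = 1) {ρ : ℝ} (h0 : 0 ≤ ρ)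
    (h1 : ρ ≤ 1) :
    ‖u - b‖ ≤ 2 * ‖ρ * u - b‖ := by
  have e1 : ‖u - ρ * u‖ = 1 - ρ := by
    rw [show u - ρ * u = ((1 - ρ : ℝ) : ℂ) * u by push_cast; ring, norm_mul, hu, Complex.norm_real,
      Real.norm_of_nonneg (by linarith), mul_one]
  have e2 : 1 - ρ ≤ ‖ρ * u - b‖ := by
    have := norm_sub_norm_le b (ρ * u)
    rw [norm_mul, hu, hb, Complex.norm_real, Real.norm_of_nonneg h0, norm_sub_rev] at this
    linarith
  calc ‖u - b‖ = ‖(u - ρ * u) + (ρ * u - b)‖ := by ring_nf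
    _ ≤ ‖u - ρ * u‖ + ‖ρ * u - b‖ := norm_add_le _ _
    _ ≤ _ := by linarith

theorem abs_cos_sub_le_norm_quadratic {β : ℝ} (h1 : -1 < β) (h2 : β < 1) {ρ : ℝ} (hρ0 : 0 ≤ ρ)
    (hρ1 : ρ ≤ 1) (θ : ℝ) :
    |Real.cos θ - β| ≤
      2 * ‖(circleMap 0 ρ θ) ^ 2 - 2 * β * circleMap 0 ρ θ + 1‖ := by
  have hs : Real.sqrt (1 - β ^ 2) ^ 2 = 1 - β ^ 2 := Real.sq_sqrt (by nlinarith)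
  set s := Real.sqrt (1 - β ^ 2)
  have hsC : (s : ℂ) ^ 2 = 1 - β ^ 2 := by exact_mod_cast hs
  set b : ℂ := β + s * Complex.I with hb
  set b' : ℂ := β - s * Complex.I with hb'
  have hprod : b * b' = 1 := by
    simp only [hb, hb']; linear_combination hsC - s ^ 2 * Complex.I_sq
  have hsum : b + b' = 2 * β := by simp only [hb, hb']; ring
  have hbn : ‖b‖ = 1 := norm_eq_one_of_quadratic h1 h2 (by rw [← hsum]; linear_combination - hprod)
  have hbn' : ‖b'‖ = 1 := norm_eq_one_of_quadratic h1 h2 (by rw [← hsum]; linear_combination - hprod)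
  set u : ℂ := Complex.exp (θ * Complex.I) with hu
  have hun : ‖u‖ = 1 := Complex.norm_exp_ofReal_mul_I θ
  have hc : circleMap 0 ρ θ = ρ * u := by simp [circleMap, hu]
  have hfac : ∀ x : ℂ, x ^ 2 - 2 * β * x + 1 = (x - b) * (x - b') := by
    intro x; rw [← hsum]; linear_combination - hprod
  have hu1 : 2 * |Real.cos θ - β| = ‖(u - b) * (u - b')‖ := by
    have : (u - b) * (u - b') = u * ((2 * (Real.cos θ - β) : ℝ) : ℂ) := by
      rw [← hfac]
      have hi : u * Complex.exp (-θ * Complex.I) = 1 := by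
        rw [hu, ← Complex.exp_add]; simp
      push_cast
      rw [Complex.cos]
      linear_combination - hi
    rw [this, norm_mul, hun, Complex.norm_real, Real.norm_eq_abs, abs_mul]
    norm_num
  rw [hc, hfac, norm_mul]
  rw [norm_mul] at hu1
  have i1 := norm_sub_le_two_mul hun hbn hρ0 hρ1
  have i2 := norm_sub_le_two_mul hun hbn' hρ0 hρ1
  nlinarith [mul_le_mul i1 i2 (norm_nonneg _) (by positivity)]

theorem intervalIntegrable_inv_sqrt : ∀ a b : ℝ,
    IntervalIntegrable (fun x : ℝ => (Real.sqrt |x|)⁻¹) volume a b := by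
  have key : ∀ b : ℝ, 0 ≤ b → IntervalIntegrable (fun x : ℝ => (Real.sqrt |x|)⁻¹) volume 0 b := by
    intro b hb
    refine (intervalIntegral.intervalIntegrable_rpow' (r := -(1/2)) (by norm_num)).congr ?_
    intro x hx
    rw [Set.uIoc_of_le hb] at hx
    simp only
    rw [abs_of_pos hx.1, Real.sqrt_eq_rpow, Real.rpow_neg hx.1.le]
  have key' : ∀ b : ℝ, IntervalIntegrable (fun x : ℝ => (Real.sqrt |x|)⁻¹) volume 0 b := by
    intro b
    rcases le_total 0 b with hb | hb
    · exact key b hb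
    · have := (key (-b) (by linarith)).comp_sub_left 0
      simpa using this
  exact fun a b => (key' a).symm.trans (key' b)

theorem intervalIntegrable_inv_sqrt_cos_sub {β : ℝ} (h1 : -1 < β) (h2 : β < 1) :
    IntervalIntegrable (fun θ : ℝ => (Real.sqrt |Real.cos θ - β|)⁻¹) volume 0 (2 * Real.pi) := by
  have hpi := Real.pi_pos
  have first : IntervalIntegrable (fun θ : ℝ => (Real.sqrt |Real.cos θ - β|)⁻¹) volume 0 Real.pi := by
    set τ := Real.arccos β with hτ
    have hcos : Real.cos τ = β := Real.cos_arccos h1.le h2.le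
    have hτ0 : 0 < τ := Real.arccos_pos.2 h2
    have hτ1 : τ < Real.pi := by
      rw [hτ, ← Real.arccos_neg_one]
      exact Real.arccos_lt_arccos le_rfl h1 h2.le
    set m := min τ (Real.pi - τ) / Real.pi with hm
    have hm0 : 0 < m := div_pos (lt_min hτ0 (by linarith)) hpi
    set k := 2 * m / Real.pi with hk
    have hk0 : 0 < k := by positivity
    have bound : ∀ θ ∈ Set.Ioc 0 Real.pi, k * |θ - τ| ≤ |Real.cos θ - β| := by
      intro θ hθ
      rw [← hcos, Real.cos_sub_cos, abs_mul, abs_mul]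
      have hA : m ≤ |Real.sin ((θ + τ) / 2)| := by
        refine le_trans ?_ (le_abs_self _)
        rw [hm, div_le_iff₀ hpi]
        rcases le_total ((θ + τ) / 2) (Real.pi / 2) with hh | hh
        · have := Real.mul_le_sin (x := (θ + τ) / 2) (by linarith [hθ.1]) hh
          rw [div_mul_eq_mul_div, div_le_iff₀ hpi] at this
          have := min_le_left τ (Real.pi - τ)
          linarith [hθ.1]
        · have := Real.mul_le_sin (x := Real.pi - (θ + τ) / 2) (by linarith [hθ.2]) (by linarith)
          rw [div_mul_eq_mul_div, div_le_iff₀ hpi, Real.sin_pi_sub] at this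
          have := min_le_right τ (Real.pi - τ)
          linarith [hθ.2]
      have hB : |θ - τ| / Real.pi ≤ |Real.sin ((θ - τ) / 2)| := by
        have := Real.mul_abs_le_abs_sin (x := (θ - τ) / 2)
          (by rw [abs_le]; constructor <;> linarith [hθ.1, hθ.2])
        refine le_trans (le_of_eq ?_) this
        rw [abs_div, abs_of_pos (by norm_num : (0:ℝ) < 2)]
        field_simp
      have := mul_le_mul hA hB (by positivity) (abs_nonneg _)
      have e : k * |θ - τ| = 2 * (m * (|θ - τ| / Real.pi)) := by rw [hk]; field_simp
      rw [e]
      norm_num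
      linarith
    have hint := ((intervalIntegrable_inv_sqrt (0 - τ) (Real.pi - τ)).comp_sub_right τ).const_mul
      (Real.sqrt k)⁻¹
    simp only [sub_add_cancel] at hint
    refine hint.mono_fun' (by fun_prop) ?_
    rw [Set.uIoc_of_le hpi.le]
    have hne : ∀ᵐ θ ∂(volume.restrict (Set.Ioc 0 Real.pi)), θ ≠ τ :=
      ae_restrict_of_ae (by simp [ae_iff, measure_singleton])
    filter_upwards [ae_restrict_mem measurableSet_Ioc, hne] with θ hθ hne
    rw [Real.norm_of_nonneg (by positivity), ← mul_inv, ← Real.sqrt_mul hk0.le]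
    have : 0 < |θ - τ| := abs_pos.2 (sub_ne_zero.2 hne)
    exact inv_anti₀ (by positivity) (Real.sqrt_le_sqrt (bound θ hθ))
  refine first.trans ?_
  have := first.comp_sub_left (2 * Real.pi)
  simp only [Real.cos_two_pi_sub, sub_zero] at this
  rw [show 2 * Real.pi - Real.pi = Real.pi by ring] at this
  exact this.symm

open Filter Topology

/-- The real part of the principal square root of `(ζ² - 2αζ + 1) / (ζ² - 2βζ + 1)`. -/
noncomputable def reSqrtRatio (α β : ℝ) (ζ : ℂ) : ℝ :=
  Real.sqrt ((‖(ζ ^ 2 - 2 * α * ζ + 1) / (ζ ^ 2 - 2 * β * ζ + 1)‖ +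
    ((ζ ^ 2 - 2 * α * ζ + 1) / (ζ ^ 2 - 2 * β * ζ + 1)).re) / 2)

theorem measurable_reSqrtRatio (α β : ℝ) : Measurable (reSqrtRatio α β) := by
  unfold reSqrtRatio
  fun_prop

theorem continuousAt_reSqrtRatio {α β : ℝ} {ζ : ℂ} (h : ζ ^ 2 - 2 * β * ζ + 1 ≠ 0) :
    ContinuousAt (reSqrtRatio α β) ζ := by
  unfold reSqrtRatio
  have : ContinuousAt
      (fun ζ : ℂ => (ζ ^ 2 - 2 * α * ζ + 1) / (ζ ^ 2 - 2 * β * ζ + 1)) ζ := by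
    refine ContinuousAt.div (by fun_prop) (by fun_prop) h
  exact Real.continuous_sqrt.continuousAt.comp
    ((this.norm.add (Complex.continuous_re.continuousAt.comp this)).div_const 2)

theorem reSqrtRatio_ofReal {α β : ℝ} (hα : -1 < α) (hα' : α < 1) (hβ : -1 < β) (hβ' : β < 1)
    (r : ℝ) : reSqrtRatio α β r =
      Real.sqrt ((r ^ 2 - 2 * α * r + 1) / (r ^ 2 - 2 * β * r + 1)) := by
  unfold reSqrtRatio
  have e : ((r : ℂ) ^ 2 - 2 * α * r + 1) / ((r : ℂ) ^ 2 - 2 * β * r + 1) =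
      (((r ^ 2 - 2 * α * r + 1) / (r ^ 2 - 2 * β * r + 1) : ℝ) : ℂ) := by push_cast; rfl
  have h1 : 0 < r ^ 2 - 2 * α * r + 1 := by nlinarith [sq_nonneg (r - α)]
  have h2 : 0 < r ^ 2 - 2 * β * r + 1 := by nlinarith [sq_nonneg (r - β)]
  rw [e, Complex.norm_real, Complex.ofReal_re, Real.norm_of_nonneg (by positivity)]
  congr 1
  ring

theorem quadratic_circleMap (γ θ : ℝ) :
    (circleMap 0 1 θ) ^ 2 - 2 * γ * circleMap 0 1 θ + 1 =
      circleMap 0 1 θ * ((2 * (Real.cos θ - γ) : ℝ) : ℂ) := by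
  have hi : Complex.exp (θ * Complex.I) * Complex.exp (-θ * Complex.I) = 1 := by
    rw [← Complex.exp_add]; simp
  simp only [circleMap, zero_add, Complex.ofReal_one, one_mul]
  push_cast
  rw [Complex.cos]
  linear_combination - hi

theorem reSqrtRatio_circleMap (α β θ : ℝ) :
    reSqrtRatio α β (circleMap 0 1 θ) = Real.sqrt ((Real.cos θ - α) / (Real.cos θ - β)) := by
  unfold reSqrtRatio
  have hne : circleMap 0 1 θ ≠ 0 := circleMap_ne_center one_ne_zero
  rw [quadratic_circleMap, quadratic_circleMap, mul_div_mul_left _ _ hne, ← Complex.ofReal_div,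
    mul_div_mul_left _ _ two_ne_zero, Complex.norm_real, Complex.ofReal_re, Real.norm_eq_abs]
  rcases le_total 0 ((Real.cos θ - α) / (Real.cos θ - β)) with h | h
  · rw [abs_of_nonneg h]; congr 1; ring
  · rw [abs_of_nonpos h, Real.sqrt_eq_zero_of_nonpos h]; simp

theorem reSqrtRatio_le {α β : ℝ} (hα : -1 < α) (hα' : α < 1) (hβ : -1 < β) (hβ' : β < 1)
    {ρ : ℝ} (h0 : 0 ≤ ρ) (h1 : ρ ≤ 1) {θ : ℝ} (hθ : Real.cos θ ≠ β) :
    reSqrtRatio α β (circleMap 0 ρ θ) ≤ Real.sqrt 8 * (Real.sqrt |Real.cos θ - β|)⁻¹ := by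
  unfold reSqrtRatio
  set ζ := circleMap 0 ρ θ with hζ
  have hn : ‖ζ‖ ≤ 1 := by rw [hζ, norm_circleMap_zero, abs_of_nonneg h0]; exact h1
  have hnum : ‖ζ ^ 2 - 2 * α * ζ + 1‖ ≤ 4 := by
    have i1 : ‖ζ ^ 2‖ ≤ 1 := by rw [norm_pow]; exact pow_le_one₀ (norm_nonneg _) hn
    have i2 : ‖2 * (α : ℂ) * ζ‖ ≤ 2 := by
      rw [norm_mul, norm_mul, Complex.norm_real, Complex.norm_ofNat, Real.norm_eq_abs]
      have : |α| ≤ 1 := abs_le.2 ⟨by linarith, by linarith⟩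
      nlinarith [mul_le_mul this hn (norm_nonneg _) zero_le_one]
    calc _ ≤ ‖ζ ^ 2 - 2 * α * ζ‖ + ‖(1 : ℂ)‖ := norm_add_le _ _
      _ ≤ ‖ζ ^ 2‖ + ‖2 * α * ζ‖ + ‖(1 : ℂ)‖ := by gcongr; exact norm_sub_le _ _
      _ ≤ 4 := by rw [norm_one]; linarith
  have hden := abs_cos_sub_le_norm_quadratic hβ hβ' h0 h1 θ
  rw [← hζ] at hden
  have hpos : 0 < |Real.cos θ - β| := abs_pos.2 (sub_ne_zero.2 hθ)
  rw [← Real.sqrt_inv, ← Real.sqrt_mul (by norm_num)]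
  apply Real.sqrt_le_sqrt
  have hre := Complex.re_le_norm ((ζ ^ 2 - 2 * α * ζ + 1) / (ζ ^ 2 - 2 * β * ζ + 1))
  have : ‖(ζ ^ 2 - 2 * α * ζ + 1) / (ζ ^ 2 - 2 * β * ζ + 1)‖ ≤ 8 * |Real.cos θ - β|⁻¹ := by
    rw [norm_div, div_le_iff₀ (by linarith)]
    have : 1 ≤ 2 * ‖ζ ^ 2 - 2 * β * ζ + 1‖ * |Real.cos θ - β|⁻¹ := by
      rw [← div_eq_mul_inv, le_div_iff₀ hpos]; linarith
    linarith
  linarith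

open InnerProductSpace in
theorem circleAverage_poissonKernel_reSqrtRatio {α β : ℝ} (hα : -1 < α) (hαβ : α < β) (hβ : β < 1)
    {r ρ : ℝ} (hr0 : 0 < r) (hr1 : r < 1) (hρ0 : 0 < ρ) (hρ1 : ρ < 1) :
    Real.circleAverage (poissonKernel 0 r • fun ζ => reSqrtRatio α β (ρ * ζ)) 0 1 =
      reSqrtRatio α β (ρ * r) := by
  apply HarmonicOnNhd.circleAverage_poissonKernel_smul (f := fun ζ => reSqrtRatio α β (ρ * ζ))
  · intro ζ hζ
    have hn : ‖(ρ : ℂ) * ζ‖ < 1 := by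
      rw [norm_mul, Complex.norm_real, Real.norm_of_nonneg hρ0.le]
      have : ‖ζ‖ ≤ 1 := by simpa using hζ
      nlinarith [norm_nonneg ζ]
    simp only [reSqrtRatio, ← Complex.cpow_inv_two_re]
    apply AnalyticAt.harmonicAt_re
    refine AnalyticAt.cpow (AnalyticAt.div (by fun_prop) (by fun_prop) ?_) analyticAt_const
      (quadratic_ratio_mem_slitPlane hα hαβ hβ hn)
    exact fun h => hn.ne (norm_eq_one_of_quadratic (by linarith) hβ h)
  · simpa [abs_of_pos hr0] using hr1

theorem poissonKernel_circleMap {r z : ℝ} (hr : 0 < r) (hz : 2 * r * z = r ^ 2 + 1)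
    (θ : ℝ) :
    poissonKernel 0 r (circleMap 0 1 θ) = (1 - r ^ 2) / (2 * r) * (z - Real.cos θ)⁻¹ := by
  rw [poissonKernel_def]
  simp only [sub_zero, norm_circleMap_zero, abs_one, one_pow, Complex.norm_real,
    Real.norm_of_nonneg hr.le]
  have : ‖circleMap 0 1 θ - (r : ℂ)‖ ^ 2 = 2 * r * (z - Real.cos θ) := by
    rw [Complex.sq_norm, Complex.normSq_apply]
    simp only [circleMap, zero_add, Complex.ofReal_one, one_mul, Complex.sub_re, Complex.sub_im,
      Complex.exp_ofReal_mul_I_re, Complex.exp_ofReal_mul_I_im, Complex.ofReal_re,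
      Complex.ofReal_im]
    nlinarith [Real.sin_sq_add_cos_sq θ]
  rw [this, div_mul_eq_mul_div, ← div_eq_mul_inv, div_div, mul_comm (2 * r)]

theorem ae_cos_ne {β : ℝ} (h1 : -1 < β) (h2 : β < 1) : ∀ᵐ θ : ℝ, Real.cos θ ≠ β := by
  have : ({θ : ℝ | Real.cos θ = β} : Set ℝ).Countable := by
    have h : {θ : ℝ | Real.cos θ = β} ⊆
        ⋃ k : ℤ, ({2 * k * Real.pi + Real.arccos β, 2 * k * Real.pi - Real.arccos β} : Set ℝ) := by
      intro θ hθ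
      have : Real.cos (Real.arccos β) = Real.cos θ := by
        rw [Real.cos_arccos h1.le h2.le]; exact hθ.symm
      obtain ⟨k, hk⟩ := Real.cos_eq_cos_iff.1 this
      exact Set.mem_iUnion.2 ⟨k, by simpa using hk⟩
    exact (Set.countable_iUnion fun k => (Set.toFinite _).countable).mono h
  simpa using this.ae_notMem volume

theorem integral_poisson_sqrt_cos {α β : ℝ} (hα : -1 < α) (hαβ : α < β) (hβ : β < 1)
    {r z : ℝ} (hr0 : 0 < r) (hr1 : r < 1) (hz : 2 * r * z = r ^ 2 + 1) :
    (1 - r ^ 2) / (2 * r) * (Real.pi⁻¹ * ∫ θ in (0 : ℝ)..Real.pi,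
      (z - Real.cos θ)⁻¹ * Real.sqrt ((Real.cos θ - α) / (Real.cos θ - β))) =
      Real.sqrt ((r ^ 2 - 2 * α * r + 1) / (r ^ 2 - 2 * β * r + 1)) := by
  have hz1 : 1 < z := by
    by_contra h
    nlinarith [sq_pos_of_pos (sub_pos.2 hr1)]
  have hker : ∀ θ : ℝ, 0 < z - Real.cos θ := fun θ => by linarith [Real.cos_le_one θ]
  have hker' : ∀ θ : ℝ, (z - Real.cos θ)⁻¹ ≤ (z - 1)⁻¹ := fun θ =>
    inv_anti₀ (by linarith) (by linarith [Real.cos_le_one θ])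
  have hcont : Continuous fun θ : ℝ => (z - Real.cos θ)⁻¹ :=
    Continuous.inv₀ (by fun_prop) fun θ => (hker θ).ne'
  have hbd := (intervalIntegrable_inv_sqrt_cos_sub (hα.trans hαβ) hβ).const_mul
    ((z - 1)⁻¹ * Real.sqrt 8)
  have hae := ae_cos_ne (hα.trans hαβ) hβ
  have hle : ∀ ρ ∈ Set.Icc (0 : ℝ) 1, ∀ θ : ℝ, Real.cos θ ≠ β →
      ‖(z - Real.cos θ)⁻¹ * reSqrtRatio α β (circleMap 0 ρ θ)‖ ≤
        (z - 1)⁻¹ * Real.sqrt 8 * (Real.sqrt |Real.cos θ - β|)⁻¹ := by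
    intro ρ hρ θ hθ
    have hU : 0 ≤ reSqrtRatio α β (circleMap 0 ρ θ) := Real.sqrt_nonneg _
    rw [Real.norm_of_nonneg (mul_nonneg (inv_nonneg.2 (hker θ).le) hU), mul_assoc]
    exact mul_le_mul (hker' θ) (reSqrtRatio_le hα (by linarith) (by linarith) hβ hρ.1 hρ.2 hθ) hU
      (inv_nonneg.2 (by linarith))
  have hmeas : ∀ ρ : ℝ, Measurable fun θ : ℝ =>
      (z - Real.cos θ)⁻¹ * reSqrtRatio α β (circleMap 0 ρ θ) := fun ρ =>
    hcont.measurable.mul ((measurable_reSqrtRatio α β).comp (continuous_circleMap 0 ρ).measurable)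
  have hlim : Tendsto (fun ρ : ℝ => ∫ θ in (0 : ℝ)..(2 * Real.pi),
      (z - Real.cos θ)⁻¹ * reSqrtRatio α β (circleMap 0 ρ θ)) (𝓝[<] 1)
      (𝓝 (∫ θ in (0 : ℝ)..(2 * Real.pi),
      (z - Real.cos θ)⁻¹ * reSqrtRatio α β (circleMap 0 1 θ))) := by
    refine intervalIntegral.tendsto_integral_filter_of_dominated_convergence _ ?_ ?_ hbd ?_
    · exact Eventually.of_forall fun ρ => (hmeas ρ).aestronglyMeasurable
    · filter_upwards [Ioo_mem_nhdsLT (zero_lt_one (α := ℝ))] with ρ hρ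
      filter_upwards [hae] with θ hθ _
      exact hle ρ ⟨hρ.1.le, hρ.2.le⟩ θ hθ
    · filter_upwards [hae] with θ hθ _
      refine Tendsto.const_mul _ ?_
      have hd : (circleMap 0 1 θ) ^ 2 - 2 * β * circleMap 0 1 θ + 1 ≠ 0 := by
        rw [quadratic_circleMap]
        refine mul_ne_zero (circleMap_ne_center one_ne_zero) ?_
        rw [Complex.ofReal_ne_zero]
        exact mul_ne_zero two_ne_zero (sub_ne_zero.2 hθ)
      have hc : Continuous fun ρ : ℝ => circleMap 0 ρ θ := by unfold circleMap; fun_prop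
      exact ((continuousAt_reSqrtRatio (α := α) hd).tendsto.comp hc.continuousAt.tendsto).mono_left
        nhdsWithin_le_nhds
  have hval : ∀ ρ ∈ Set.Ioo (0 : ℝ) 1, ∫ θ in (0 : ℝ)..(2 * Real.pi),
      (z - Real.cos θ)⁻¹ * reSqrtRatio α β (circleMap 0 ρ θ) =
        2 * Real.pi * ((2 * r) / (1 - r ^ 2)) * reSqrtRatio α β (ρ * r) := by
    intro ρ hρ
    have h1r : 1 - r ^ 2 ≠ 0 := by nlinarith
    rw [← circleAverage_poissonKernel_reSqrtRatio hα hαβ hβ hr0 hr1 hρ.1 hρ.2,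
      Real.circleAverage_def]
    simp only [Pi.smul_apply', smul_eq_mul, poissonKernel_circleMap hr0 hz]
    have e : ∀ θ : ℝ, (ρ : ℂ) * circleMap 0 1 θ = circleMap 0 ρ θ := by
      intro θ; simp [circleMap]
    simp only [e, mul_assoc]
    rw [intervalIntegral.integral_const_mul]
    have := Real.pi_pos.ne'
    field_simp
  have hlim' : Tendsto (fun ρ : ℝ => 2 * Real.pi * ((2 * r) / (1 - r ^ 2)) *
      reSqrtRatio α β (ρ * r)) (𝓝[<] 1)
      (𝓝 (2 * Real.pi * ((2 * r) / (1 - r ^ 2)) * reSqrtRatio α β r)) := by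
    refine Tendsto.const_mul _ ?_
    have hd : (((1 : ℝ) : ℂ) * r) ^ 2 - 2 * β * (((1 : ℝ) : ℂ) * r) + 1 ≠ 0 := by
      rw [Complex.ofReal_one, one_mul]
      intro h
      have := norm_eq_one_of_quadratic (by linarith) hβ h
      rw [Complex.norm_real, Real.norm_of_nonneg hr0.le] at this
      exact hr1.ne this
    have hc : Continuous fun ρ : ℝ => (ρ : ℂ) * r := by fun_prop
    have := ((continuousAt_reSqrtRatio (α := α) hd).tendsto.comp
      (hc.continuousAt (x := 1)).tendsto).mono_left (nhdsWithin_le_nhds (s := Set.Iio 1))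
    simpa [Function.comp_def] using this
  have heq := tendsto_nhds_unique hlim (hlim'.congr' (by
    filter_upwards [Ioo_mem_nhdsLT (zero_lt_one (α := ℝ))] with ρ hρ
    exact (hval ρ hρ).symm))
  have hint : IntervalIntegrable (fun θ : ℝ => (z - Real.cos θ)⁻¹ *
      reSqrtRatio α β (circleMap 0 1 θ)) volume 0 (2 * Real.pi) := by
    refine hbd.mono_fun' (hmeas 1).aestronglyMeasurable (ae_restrict_of_ae ?_)
    filter_upwards [hae] with θ hθ
    exact hle 1 ⟨zero_le_one, le_rfl⟩ θ hθ
  simp only [reSqrtRatio_circleMap] at heq hint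
  rw [reSqrtRatio_ofReal hα (by linarith) (by linarith) hβ] at heq
  have hpi := Real.pi_pos
  have hsub : Set.uIcc 0 Real.pi ⊆ Set.uIcc 0 (2 * Real.pi) := by
    rw [Set.uIcc_of_le hpi.le, Set.uIcc_of_le (by linarith)]
    exact Set.Icc_subset_Icc le_rfl (by linarith)
  have hsub' : Set.uIcc Real.pi (2 * Real.pi) ⊆ Set.uIcc 0 (2 * Real.pi) := by
    rw [Set.uIcc_of_le (by linarith), Set.uIcc_of_le (by linarith)]
    exact Set.Icc_subset_Icc hpi.le le_rfl
  rw [← intervalIntegral.integral_add_adjacent_intervals (hint.mono_set hsub)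
    (hint.mono_set hsub')] at heq
  have hsymm := intervalIntegral.integral_comp_sub_left (a := Real.pi) (b := 2 * Real.pi)
    (fun θ : ℝ => (z - Real.cos θ)⁻¹ * Real.sqrt ((Real.cos θ - α) / (Real.cos θ - β)))
    (2 * Real.pi)
  simp only [Real.cos_two_pi_sub, sub_self] at hsymm
  rw [show 2 * Real.pi - Real.pi = Real.pi by ring] at hsymm
  rw [hsymm] at heq
  have h1r : 1 - r ^ 2 ≠ 0 := by nlinarith
  field_simp at heq ⊢
  linarith

theorem stieltjes_transform_eq {α β : ℝ} (hα : -1 < α) (hαβ : α < β) (hβ : β < 1)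
    {w : ℝ → ℝ}
    (hw : ∀ x, w x = (1 / Real.pi) * Real.sqrt ((x - α) / ((1 - x ^ 2) * (x - β))))
    {z : ℝ} (hz : 1 < z) :
    (∫ t in Set.Icc (-1) α ∪ Set.Icc β 1, (z - t)⁻¹ * w t) =
      Real.sqrt ((z - α) / ((z ^ 2 - 1) * (z - β))) := by
  have hz2 : 0 < z ^ 2 - 1 := by nlinarith
  set y := Real.sqrt (z ^ 2 - 1) with hy
  have hy2 : y ^ 2 = z ^ 2 - 1 := Real.sq_sqrt hz2.le
  have hy0 : 0 < y := Real.sqrt_pos.2 hz2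
  set r := z - y with hr
  have hr0 : 0 < r := by nlinarith
  have hr1 : r < 1 := by nlinarith
  have hrz : 2 * r * z = r ^ 2 + 1 := by rw [hr]; nlinarith
  have main := integral_poisson_sqrt_cos hα hαβ hβ hr0 hr1 hrz
  have hsub : Set.Icc (-1) α ∪ Set.Icc β 1 ⊆ Set.Icc (-1 : ℝ) 1 :=
    Set.union_subset (Set.Icc_subset_Icc le_rfl (by linarith))
      (Set.Icc_subset_Icc (by linarith) le_rfl)
  have hE : (∫ t in Set.Icc (-1) α ∪ Set.Icc β 1, (z - t)⁻¹ * w t) =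
      ∫ t in (-1 : ℝ)..1, (z - t)⁻¹ * w t := by
    rw [intervalIntegral.integral_of_le (by norm_num), ← integral_Icc_eq_integral_Ioc]
    symm
    apply setIntegral_eq_of_subset_of_forall_sdiff_eq_zero measurableSet_Icc hsub
    rintro t ⟨ht, ht'⟩
    simp only [Set.mem_union, Set.mem_Icc, not_or, not_and, not_le] at ht ht'
    have h1 := ht'.1 ht.1
    have h2 : t < β := by by_contra h; linarith [ht'.2 (not_lt.1 h), ht.2]
    rw [hw, Real.sqrt_eq_zero_of_nonpos, mul_zero, mul_zero]
    apply div_nonpos_of_nonneg_of_nonpos (by linarith)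
    exact mul_nonpos_of_nonneg_of_nonpos (by nlinarith [ht.1, ht.2]) (by linarith)
  have hcos : (∫ t in (-1 : ℝ)..1, (z - t)⁻¹ * w t) = Real.pi⁻¹ * ∫ θ in (0 : ℝ)..Real.pi,
      (z - Real.cos θ)⁻¹ * Real.sqrt ((Real.cos θ - α) / (Real.cos θ - β)) := by
    rw [← Polynomial.Chebyshev.integral_measureT_eq_integral_cos
      (f := fun x => (z - x)⁻¹ * Real.sqrt ((x - α) / (x - β))),
      Polynomial.Chebyshev.integral_measureT, ← intervalIntegral.integral_const_mul]
    apply intervalIntegral.integral_congr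
    intro t ht
    rw [Set.uIcc_of_le (by norm_num)] at ht
    have h1 : 0 ≤ (1 - t ^ 2)⁻¹ := inv_nonneg.2 (by nlinarith [ht.1, ht.2])
    simp only
    rw [hw, ← div_div, div_right_comm, div_eq_mul_inv _ (1 - t ^ 2), Real.sqrt_mul' _ h1]
    ring
  rw [hE, hcos]
  have hyr : (1 - r ^ 2) / (2 * r) = y := by
    rw [div_eq_iff (by positivity)]; rw [hr]; nlinarith
  have hq : ∀ γ : ℝ, r ^ 2 - 2 * γ * r + 1 = 2 * r * (z - γ) := fun γ => by linarith
  rw [hyr, hq, hq, mul_div_mul_left _ _ (by positivity)] at main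
  rw [mul_comm (z ^ 2 - 1), ← div_div, Real.sqrt_div (div_nonneg (by linarith) (by linarith)), ← hy,
    ← main, mul_div_cancel_left₀ _ hy0.ne']

section Orthogonality

variable {L : ℝ[X] →ₗ[ℝ] ℝ} {P : ℕ → ℝ[X]} {h : ℕ → ℝ}

theorem orthogonal_of_degree_lt (hPmonic : ∀ n, (P n).Monic) (hPdeg : ∀ n, (P n).natDegree = n)
    (horth : ∀ n m, L (P n * P m) = if n = m then h n else 0) {n : ℕ} {q : ℝ[X]}
    (hq : q.degree < n) : L (P n * q) = 0 := by
  have key : ∀ m ≤ n, ∀ q : ℝ[X], q.degree < m → L (P n * q) = 0 := by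
    intro m
    induction m with
    | zero =>
      intro _ q hq
      have : q = 0 := by
        rw [← degree_eq_bot]
        exact Nat.WithBot.lt_zero_iff.1 (by simpa using hq)
      simp [this]
    | succ m ih =>
      intro hm q hq
      have hlt : (q - C (q.coeff m) * P m).degree < m := by
        rw [degree_lt_iff_coeff_zero]
        intro k hk
        rw [coeff_sub, coeff_C_mul]
        rcases hk.eq_or_lt with rfl | hk
        · have := (hPmonic m).coeff_natDegree
          rw [hPdeg] at this
          rw [this]; ring
        · rw [coeff_eq_zero_of_natDegree_lt (p := P m) (by rw [hPdeg]; exact hk),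
            (degree_lt_iff_coeff_zero q (m + 1)).1 (by exact_mod_cast hq) k hk]
          ring
      have h1 := ih (by omega) _ hlt
      have h2 := horth n m
      rw [if_neg (by omega)] at h2
      rw [mul_sub, map_sub, mul_left_comm, ← smul_eq_C_mul, map_smul, h2, smul_zero, sub_zero] at h1
      exact h1
  exact key n le_rfl q hq

theorem orthogonal_monic (hPmonic : ∀ n, (P n).Monic) (hPdeg : ∀ n, (P n).natDegree = n)
    (horth : ∀ n m, L (P n * P m) = if n = m then h n else 0) {n : ℕ} {q : ℝ[X]}
    (hq : q.Monic) (hdeg : q.natDegree = n) : L (P n * q) = h n := by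
  have hd : (q - P n).degree < n := by
    have hqd : q.degree = n := by rw [degree_eq_natDegree hq.ne_zero, hdeg]
    have hpd : (P n).degree = n := by rw [degree_eq_natDegree (hPmonic n).ne_zero, hPdeg]
    rw [← hqd]
    exact degree_sub_lt_left (hqd.trans hpd.symm) hq.ne_zero
      (hq.leadingCoeff.trans (hPmonic n).leadingCoeff.symm)
  have h1 := orthogonal_of_degree_lt hPmonic hPdeg horth hd
  rw [mul_sub, map_sub, horth, if_pos rfl] at h1
  linarith

end Orthogonality

section Transform

variable {E : Set ℝ} {w : ℝ → ℝ}

/-- Integration of polynomials against the weight `w` on `E`, as a linear functional. -/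
noncomputable def weightFunctional (hE : IsCompact E) (hw : IntegrableOn w E) : ℝ[X] →ₗ[ℝ] ℝ where
  toFun p := ∫ t in E, p.eval t * w t
  map_add' p q := by
    simp only [eval_add, add_mul]
    exact integral_add (hw.continuousOn_mul p.continuous.continuousOn hE)
      (hw.continuousOn_mul q.continuous.continuousOn hE)
  map_smul' c p := by
    simp only [eval_smul, smul_eq_mul, mul_assoc, integral_const_mul, RingHom.id_apply]

theorem weightFunctional_apply (hE : IsCompact E) (hw : IntegrableOn w E) (p : ℝ[X]) :
    weightFunctional hE hw p = ∫ t in E, p.eval t * w t := rfl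

/-- The Stieltjes transform of the polynomial `p` times the weight `w` on `E`. -/
noncomputable def polyTransform (E : Set ℝ) (w : ℝ → ℝ) (p : ℝ[X]) (z : ℝ) : ℝ :=
  ∫ t in E, p.eval t * ((z - t)⁻¹ * w t)

theorem integrableOn_polyTransform (hE : IsCompact E) (hEsub : E ⊆ Set.Icc (-1) 1)
    (hw : IntegrableOn w E) {z : ℝ} (hz : 1 < z) (p : ℝ[X]) :
    IntegrableOn (fun t => p.eval t * ((z - t)⁻¹ * w t)) E := by
  refine IntegrableOn.continuousOn_mul p.continuous.continuousOn ?_ hE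
  refine IntegrableOn.continuousOn_mul ?_ hw hE
  exact ContinuousOn.inv₀ (by fun_prop) fun t ht => by linarith [(hEsub ht).2]

theorem eval_sub_eval_eq (p : ℝ[X]) (z t : ℝ) :
    p.eval z - p.eval t = (z - t) * (p /ₘ (X - C z)).eval t := by
  have := congrArg (eval t) (modByMonic_add_div p (X - C z))
  rw [modByMonic_X_sub_C_eq_C_eval] at this
  simp only [eval_add, eval_C, eval_mul, eval_sub, eval_X] at this
  linarith

theorem eval_mul_polyTransform (hE : IsCompact E) (hEsub : E ⊆ Set.Icc (-1) 1)
    (hw : IntegrableOn w E) {z : ℝ} (hz : 1 < z) (p q : ℝ[X]) :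
    p.eval z * polyTransform E w q z =
      polyTransform E w (p * q) z + weightFunctional hE hw (q * (p /ₘ (X - C z))) := by
  rw [weightFunctional_apply, polyTransform, polyTransform, ← integral_const_mul, ← integral_add
    (integrableOn_polyTransform hE hEsub hw hz _)
    (hw.continuousOn_mul (q * (p /ₘ (X - C z))).continuous.continuousOn hE)]
  refine setIntegral_congr_fun hE.measurableSet fun t ht => ?_
  have hne : z - t ≠ 0 := by linarith [(hEsub ht).2]
  have := eval_sub_eval_eq p z t
  have hp : p.eval z = p.eval t + (z - t) * (p /ₘ (X - C z)).eval t := by linarith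
  simp only [eval_mul]
  rw [hp]
  field_simp

theorem tendsto_polyTransform (hE : IsCompact E) (hEsub : E ⊆ Set.Icc (-1) 1)
    (hw : IntegrableOn w E) (p : ℝ[X]) :
    Tendsto (polyTransform E w p) atTop (𝓝 0) := by
  have hlim : Tendsto (fun z : ℝ => (z - 1)⁻¹ * ∫ t in E, ‖p.eval t * w t‖) atTop (𝓝 0) := by
    have : Tendsto (fun z : ℝ => (z - 1)⁻¹) atTop (𝓝 0) :=
      tendsto_inv_atTop_zero.comp (tendsto_atTop_add_const_right _ (-1) tendsto_id)
    simpa using this.mul_const (∫ t in E, ‖p.eval t * w t‖)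
  refine squeeze_zero_norm' ?_ hlim
  filter_upwards [eventually_gt_atTop 1] with z hz
  rw [polyTransform, ← integral_const_mul]
  refine norm_integral_le_of_norm_le
    ((hw.continuousOn_mul p.continuous.continuousOn hE).norm.const_mul _) ?_
  filter_upwards [ae_restrict_mem hE.measurableSet] with t ht
  have h1 : 0 < z - 1 := by linarith
  have h2 : z - 1 ≤ z - t := by linarith [(hEsub ht).2]
  rw [mul_left_comm, norm_mul, Real.norm_of_nonneg (inv_nonneg.2 (h1.trans_le h2).le)]
  exact mul_le_mul_of_nonneg_right (inv_anti₀ h1 h2) (norm_nonneg _)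

theorem self_mul_polyTransform (hE : IsCompact E) (hEsub : E ⊆ Set.Icc (-1) 1)
    (hw : IntegrableOn w E) {z : ℝ} (hz : 1 < z) (p : ℝ[X]) :
    z * polyTransform E w p z = polyTransform E w (X * p) z + weightFunctional hE hw p := by
  have h := eval_mul_polyTransform hE hEsub hw hz X p
  have hdiv : (X : ℝ[X]) /ₘ (X - C z) = 1 := by
    have := modByMonic_add_div (X : ℝ[X]) (X - C z)
    rw [modByMonic_X_sub_C_eq_C_eval, eval_X] at this
    refine mul_left_cancel₀ (X_sub_C_ne_zero z) ?_
    linear_combination this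
  rwa [hdiv, eval_X, mul_one] at h

theorem tendsto_self_mul_polyTransform (hE : IsCompact E) (hEsub : E ⊆ Set.Icc (-1) 1)
    (hw : IntegrableOn w E) (p : ℝ[X]) :
    Tendsto (fun z => z * polyTransform E w p z) atTop (𝓝 (weightFunctional hE hw p)) := by
  have h := (tendsto_polyTransform hE hEsub hw (X * p)).add_const (weightFunctional hE hw p)
  rw [zero_add] at h
  refine h.congr' ?_
  filter_upwards [eventually_gt_atTop 1] with z hz
  exact (self_mul_polyTransform hE hEsub hw hz p).symm

theorem tendsto_sq_mul_polyTransform (hE : IsCompact E) (hEsub : E ⊆ Set.Icc (-1) 1)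
    (hw : IntegrableOn w E) (p : ℝ[X]) (hp : weightFunctional hE hw p = 0) :
    Tendsto (fun z => z ^ 2 * polyTransform E w p z) atTop
      (𝓝 (weightFunctional hE hw (X * p))) := by
  refine (tendsto_self_mul_polyTransform hE hEsub hw (X * p)).congr' ?_
  filter_upwards [eventually_gt_atTop 1] with z hz
  have := self_mul_polyTransform hE hEsub hw hz p
  rw [hp, add_zero] at this
  rw [← this]; ring

end Transform

theorem tendsto_sqrt_quartic_div_sq (α β : ℝ) :
    Tendsto (fun z : ℝ => Real.sqrt ((z ^ 2 - 1) * (z - α) * (z - β)) / z ^ 2) atTop (𝓝 1) := by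
  have hc : Continuous fun v : ℝ => Real.sqrt ((1 - v ^ 2) * (1 - α * v) * (1 - β * v)) := by
    fun_prop
  have h := (hc.tendsto 0).comp tendsto_inv_atTop_zero
  norm_num at h
  refine h.congr' ?_
  filter_upwards [eventually_gt_atTop 0] with z hz
  have hz2 : Real.sqrt (z ^ 4) = z ^ 2 := by
    rw [show z ^ 4 = (z ^ 2) ^ 2 by ring, Real.sqrt_sq (by positivity)]
  have e : (1 - z⁻¹ ^ 2) * (1 - α * z⁻¹) * (1 - β * z⁻¹) =
      (z ^ 2 - 1) * (z - α) * (z - β) / z ^ 4 := by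
    field_simp
  simp only [Function.comp]
  rw [e, Real.sqrt_div' _ (by positivity), hz2]

theorem tendsto_sqrt_quartic_sub {α β : ℝ} (hα : α < 1) (hβ : β < 1) :
    Tendsto (fun z : ℝ => Real.sqrt ((z ^ 2 - 1) * (z - α) * (z - β)) -
      (z ^ 2 - (α + β) / 2 * z - (α - β) ^ 2 / 8 - 1 / 2)) atTop (𝓝 0) := by
  set c := (α - β) ^ 2 / 8 + 1 / 2 with hc
  have hnum : Tendsto (fun z : ℝ => ((α + β) * (1 - c)) * z⁻¹ + (-(α * β) - c ^ 2) * (z⁻¹) ^ 2)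
      atTop (𝓝 0) := by
    have hcont : Continuous fun v : ℝ =>
      ((α + β) * (1 - c)) * v + (-(α * β) - c ^ 2) * v ^ 2 := by fun_prop
    have h := (hcont.tendsto 0).comp tendsto_inv_atTop_zero
    norm_num at h
    exact h
  have hM : Tendsto (fun z : ℝ => 1 - (α + β) / 2 * z⁻¹ - c * (z⁻¹) ^ 2) atTop (𝓝 1) := by
    have hcont : Continuous fun v : ℝ => 1 - (α + β) / 2 * v - c * v ^ 2 := by fun_prop
    have h := (hcont.tendsto 0).comp tendsto_inv_atTop_zero
    norm_num at h
    exact h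
  have hsum := (tendsto_sqrt_quartic_div_sq α β).add hM
  have h := hnum.div hsum (by norm_num)
  rw [zero_div] at h
  refine h.congr' ?_
  filter_upwards [eventually_gt_atTop 1,
    hsum.eventually (lt_mem_nhds (show (0 : ℝ) < 1 + 1 by norm_num))] with z hz hpos
  have hz0 : z ≠ 0 := by linarith
  have hsq := Real.sq_sqrt (show 0 ≤ (z ^ 2 - 1) * (z - α) * (z - β) from
    mul_nonneg (mul_nonneg (by nlinarith) (by linarith)) (by linarith))
  simp only [Pi.div_apply]
  rw [div_eq_iff hpos.ne']
  set Y := Real.sqrt ((z ^ 2 - 1) * (z - α) * (z - β))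
  field_simp
  rw [hc]
  linear_combination (-32) * hsq

/-- explicit form of `G₂(x;n)` for genus one. -/
theorem G2_explicit
    (α β : ℝ) (hα : (-1:ℝ) < α) (hαβ : α < β) (hβ : β < 1)
    (E : Set ℝ) (hE : E = Set.Icc (-1) α ∪ Set.Icc β 1)
    (w : ℝ → ℝ)
    (hw : ∀ x, w x = (1 / Real.pi) * Real.sqrt ((x - α) / ((1 - x ^ 2) * (x - β))))
    (hw0 : ∀ x ∈ E, 0 ≤ w x)
    (hwint : MeasureTheory.IntegrableOn w E)
    (P : ℕ → Polynomial ℝ) (h : ℕ → ℝ) (a b : ℕ → ℝ)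
    (hPmonic : ∀ n, (P n).Monic)
    (hPdeg : ∀ n, (P n).natDegree = n)
    (hh : ∀ n, 0 < h n)
    (horth : ∀ n m, ∫ x in E, (P n).eval x * (P m).eval x * w x = if n = m then h n else 0)
    (ha : ∀ n, 1 ≤ n → 0 < a n)
    (hrec0 : P 1 = (Polynomial.X - Polynomial.C (b 1)) * P 0)
    (hrec : ∀ n, 1 ≤ n →
      P (n + 1) = (Polynomial.X - Polynomial.C (b (n + 1))) * P n - Polynomial.C (a n) * P (n - 1))
    (Q : ℕ → Polynomial ℝ)
    (hQ : ∀ n x, (Q n).eval x = ∫ t in E, ((P n).eval x - (P n).eval t) / (x - t) * w t)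
    (n : ℕ) (hn : 2 ≤ n) :
    ∀ x : ℝ,
      (P n).eval x * (P (n - 1)).eval x * (x - α)
        - (Q n).eval x * (Q (n - 1)).eval x * (x ^ 2 - 1) * (x - β) =
      h (n - 1) * (x ^ 2 - ((α + β) / 2) * x + 2 * a n - (α - β) ^ 2 / 8 - 1 / 2) := by
  obtain ⟨m, rfl⟩ : ∃ m, n = m + 1 := ⟨n - 1, by omega⟩
  have hm : 1 ≤ m := by omega
  simp only [Nat.add_sub_cancel]
  have hEc : IsCompact E := hE ▸ isCompact_Icc.union isCompact_Icc
  have hEsub : E ⊆ Set.Icc (-1 : ℝ) 1 := by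
    rw [hE]
    exact Set.union_subset (Set.Icc_subset_Icc le_rfl (by linarith))
      (Set.Icc_subset_Icc (by linarith) le_rfl)
  set L := weightFunctional hEc hwint with hL
  have hLorth : ∀ n m, L (P n * P m) = if n = m then h n else 0 := by
    intro n m
    rw [hL, weightFunctional_apply, ← horth n m]
    simp only [eval_mul]
  have orth {n : ℕ} {q : ℝ[X]} (hq : q.degree < n) : L (P n * q) = 0 :=
    orthogonal_of_degree_lt hPmonic hPdeg hLorth hq
  have hLP : ∀ k, 1 ≤ k → L (P k) = 0 := by
    intro k hk
    have := orth (n := k) (q := 1) (by rw [degree_one]; exact_mod_cast hk)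
    rwa [mul_one] at this
  have hLXP : L (X * P (m + 1)) = 0 := by
    rw [mul_comm]
    refine orth ?_
    rw [degree_X]
    exact_mod_cast hn
  have hLXPP : L (X * (P m * P (m + 1))) = a (m + 1) * h m := by
    have h1 := hLorth (m + 2) m
    rw [if_neg (by omega), hrec (m + 1) (by omega), Nat.add_sub_cancel] at h1
    have e : ((X - C (b (m + 1 + 1))) * P (m + 1) - C (a (m + 1)) * P m) * P m =
        X * (P m * P (m + 1)) - b (m + 1 + 1) • (P (m + 1) * P m) - a (m + 1) • (P m * P m) := by
      simp only [smul_eq_C_mul]; ring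
    rw [e, map_sub, map_sub, map_smul, map_smul, hLorth, hLorth, if_neg (by omega), if_pos rfl,
      smul_zero, smul_eq_mul] at h1
    linarith
  set K := polyTransform E w with hK
  have hS := tendsto_sq_mul_polyTransform hEc hEsub hwint (P m * P (m + 1))
    (by rw [← hL, hLorth, if_neg (by omega)])
  have hR := tendsto_sq_mul_polyTransform hEc hEsub hwint (P (m + 1)) (hLP _ (by omega))
  have hR' := tendsto_self_mul_polyTransform hEc hEsub hwint (P m)
  rw [← hL, ← hK] at hS hR hR'
  rw [hLXPP] at hS
  rw [hLXP] at hR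
  rw [hLP m hm] at hR'
  set D : ℝ[X] := (P (m + 1) * P m * (X - C α) - Q (m + 1) * Q m * (X ^ 2 - 1) * (X - C β)) -
    C (h m) * (X ^ 2 - C ((α + β) / 2) * X + C (2 * a (m + 1) - (α - β) ^ 2 / 8 - 1 / 2)) with hD
  have hQK : ∀ z, 1 < z → ∀ k, (Q k).eval z = (P k).eval z * K 1 z - K (P k) z := by
    intro z hz k
    have h1 := eval_mul_polyTransform hEc hEsub hwint hz (P k) 1
    rw [mul_one, one_mul, weightFunctional_apply] at h1
    rw [hK, h1, add_sub_cancel_left, hQ]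
    refine setIntegral_congr_fun hEc.measurableSet fun t ht => ?_
    have hne : z - t ≠ 0 := by linarith [(hEsub ht).2]
    rw [eval_sub_eval_eq, mul_div_cancel_left₀ _ hne]
  have hlim : Tendsto (fun z => D.eval z) atTop (𝓝 0) := by
    have t1 := (tendsto_sqrt_quartic_sub (hαβ.trans hβ) hβ).const_mul (h m)
    have t2 := (((tendsto_sqrt_quartic_div_sq α β).mul hS).sub_const (a (m + 1) * h m)).const_mul 2
    have t3 : Tendsto (fun z : ℝ => (1 - (z⁻¹) ^ 2) * (1 - β * z⁻¹)) atTop (𝓝 1) := by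
      have hcont : Continuous fun v : ℝ => (1 - v ^ 2) * (1 - β * v) := by fun_prop
      have h := (hcont.tendsto 0).comp tendsto_inv_atTop_zero
      norm_num at h
      exact h
    have t4 := (t1.add t2).sub (t3.mul (hR.mul hR'))
    simp only [mul_zero, one_mul, sub_self, add_zero] at t4
    refine t4.congr' ?_
    filter_upwards [eventually_gt_atTop 1] with z hz
    have hz0 : z ≠ 0 := by linarith
    have hz1 : 0 < z ^ 2 - 1 := by nlinarith
    have hzα : 0 < z - α := by linarith
    have hzβ : 0 < z - β := by linarith
    have hF : K 1 z = Real.sqrt ((z - α) / ((z ^ 2 - 1) * (z - β))) := by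
      rw [← stieltjes_transform_eq hα hαβ hβ hw hz, ← hE]
      simp [hK, polyTransform]
    have hF2 : (z ^ 2 - 1) * (z - β) * K 1 z ^ 2 = z - α := by
      rw [hF, Real.sq_sqrt (by positivity)]
      field_simp
    have hF0 : 0 ≤ K 1 z := hF ▸ Real.sqrt_nonneg _
    have hY : Real.sqrt ((z ^ 2 - 1) * (z - α) * (z - β)) = (z ^ 2 - 1) * (z - β) * K 1 z := by
      rw [Real.sqrt_eq_iff_mul_self_eq (by positivity) (by positivity)]
      linear_combination (-((z ^ 2 - 1) * (z - β))) * hF2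
    have i1 := eval_mul_polyTransform hEc hEsub hwint hz (P m) (P (m + 1))
    have i2 := eval_mul_polyTransform hEc hEsub hwint hz (P (m + 1)) (P m)
    rw [← hL, ← hK] at i1 i2
    have j1 : L (P (m + 1) * (P m /ₘ (X - C z))) = 0 := by
      refine orth ((degree_divByMonic_le _ _).trans_lt ?_)
      rw [degree_eq_natDegree (hPmonic m).ne_zero, hPdeg]
      exact_mod_cast Nat.lt_succ_self m
    have j2 : L (P m * (P (m + 1) /ₘ (X - C z))) = h m := by
      refine orthogonal_monic hPmonic hPdeg hLorth ?_ ?_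
      · rw [Monic, leadingCoeff_divByMonic_X_sub_C, hPmonic]
        rw [degree_eq_natDegree (hPmonic _).ne_zero, hPdeg]
        exact_mod_cast Nat.succ_ne_zero m
      · rw [natDegree_divByMonic _ (monic_X_sub_C z), hPdeg, natDegree_X_sub_C, Nat.add_sub_cancel]
    rw [j1] at i1
    rw [j2, mul_comm (P (m + 1)) (P m)] at i2
    rw [hY, hD]
    simp only [eval_sub, eval_mul, eval_add, eval_C, eval_X, eval_pow, eval_one, hQK z hz]
    have e2 : (z ^ 2 - 1) * (z - β) * K 1 z / z ^ 2 * (z ^ 2 * K (P m * P (m + 1)) z) =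
        (z ^ 2 - 1) * (z - β) * K 1 z * K (P m * P (m + 1)) z := by
      field_simp
    have e3 : (1 - z⁻¹ ^ 2) * (1 - β * z⁻¹) * (z ^ 2 * K (P (m + 1)) z * (z * K (P m) z)) =
        (z ^ 2 - 1) * (z - β) * K (P (m + 1)) z * K (P m) z := by
      field_simp
    rw [e2, e3]
    linear_combination (-((z ^ 2 - 1) * (z - β) * K 1 z)) * (i1 + i2) +
      eval z (P (m + 1)) * eval z (P m) * hF2
  have hD0 : D = 0 := leadingCoeff_eq_zero.1 ((tendsto_nhds_iff D).1 hlim).1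
  intro x
  have := congrArg (eval x) hD0
  rw [hD] at this
  simp only [eval_sub, eval_mul, eval_add, eval_C, eval_X, eval_pow, eval_one, eval_zero] at this
  linear_combination this
end

section
/- The recurrence coefficients satisfy, for every n ≥ 3: a_n + a_{n−1} = 1/2 + (β − α)²/8 + ((α + β)/2) · b_n − b_n². -/
open MeasureTheory Polynomial

/-- The Stieltjes transform of `p dν`. -/
noncomputable def stieltjes (ν : Measure ℝ) (p : ℝ[X]) (z : ℝ) : ℝ :=
  ∫ x, p.eval x * (z - x)⁻¹ ∂ν

section Stieltjes

variable {ν : Measure ℝ} [IsFiniteMeasure ν]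

lemma integrable_of_continuousOn_of_ae_mem_Icc {u v : ℝ} (hν : ∀ᵐ x ∂ν, x ∈ Set.Icc u v)
    {f : ℝ → ℝ} (hf : ContinuousOn f (Set.Icc u v)) : Integrable f ν := by
  have h := hf.integrableOn_compact (μ := ν) isCompact_Icc
  rwa [IntegrableOn, Measure.restrict_eq_self_of_ae_mem hν] at h

lemma integrable_eval (hν : ∀ᵐ x ∂ν, x ∈ Set.Icc (-1 : ℝ) 1) (p : ℝ[X]) :
    Integrable (fun x => p.eval x) ν :=
  integrable_of_continuousOn_of_ae_mem_Icc hν p.continuous.continuousOn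

lemma integrable_eval_mul_inv_sub (hν : ∀ᵐ x ∂ν, x ∈ Set.Icc (-1 : ℝ) 1) (p : ℝ[X])
    {z : ℝ} (hz : 1 < z) : Integrable (fun x => p.eval x * (z - x)⁻¹) ν := by
  refine integrable_of_continuousOn_of_ae_mem_Icc hν (p.continuous.continuousOn.mul ?_)
  refine ContinuousOn.inv₀ (by fun_prop) fun x hx => ?_
  linarith [hx.2]

lemma stieltjes_add (hν : ∀ᵐ x ∂ν, x ∈ Set.Icc (-1 : ℝ) 1) (p q : ℝ[X]) {z : ℝ} (hz : 1 < z) :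
    stieltjes ν (p + q) z = stieltjes ν p z + stieltjes ν q z := by
  simp only [stieltjes, eval_add, add_mul]
  exact integral_add (integrable_eval_mul_inv_sub hν p hz) (integrable_eval_mul_inv_sub hν q hz)

omit [IsFiniteMeasure ν] in
lemma stieltjes_C_mul (c : ℝ) (p : ℝ[X]) (z : ℝ) :
    stieltjes ν (C c * p) z = c * stieltjes ν p z := by
  simp only [stieltjes, eval_mul, eval_C, mul_assoc]
  exact integral_const_mul _ _

omit [IsFiniteMeasure ν] in
lemma stieltjes_X_sub_C_mul (hν : ∀ᵐ x ∂ν, x ∈ Set.Icc (-1 : ℝ) 1) (p : ℝ[X])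
    {z : ℝ} (hz : 1 < z) :
    stieltjes ν ((X - C z) * p) z = - ∫ x, p.eval x ∂ν := by
  rw [stieltjes, ← integral_neg]
  refine integral_congr_ae ?_
  filter_upwards [hν] with x hx
  have : z - x ≠ 0 := by linarith [hx.2]
  simp only [eval_mul, eval_sub, eval_X, eval_C]
  field_simp
  ring

lemma stieltjes_X_mul (hν : ∀ᵐ x ∂ν, x ∈ Set.Icc (-1 : ℝ) 1) (p : ℝ[X])
    {z : ℝ} (hz : 1 < z) :
    stieltjes ν (X * p) z = z * stieltjes ν p z - ∫ x, p.eval x ∂ν := by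
  have h : X * p = (X - C z) * p + C z * p := by ring
  rw [h, stieltjes_add hν _ _ hz, stieltjes_C_mul, stieltjes_X_sub_C_mul hν p hz]
  ring

/-- The associated polynomial (function of the second kind). -/
lemma exists_eval_eq_mul_stieltjes_sub (hν : ∀ᵐ x ∂ν, x ∈ Set.Icc (-1 : ℝ) 1) (p : ℝ[X]) :
    ∃ q : ℝ[X], ∀ z, 1 < z → q.eval z = p.eval z * stieltjes ν 1 z - stieltjes ν p z := by
  induction p using Polynomial.induction_on with
  | C c =>
    refine ⟨0, fun z _ => ?_⟩
    have := stieltjes_C_mul (ν := ν) c 1 z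
    rw [mul_one] at this
    simp [this]
  | add p q hp hq =>
    obtain ⟨p', hp⟩ := hp
    obtain ⟨q', hq⟩ := hq
    refine ⟨p' + q', fun z hz => ?_⟩
    rw [eval_add, eval_add, hp z hz, hq z hz, stieltjes_add hν _ _ hz]
    ring
  | monomial k c ih =>
    obtain ⟨q, hq⟩ := ih
    refine ⟨X * q + C (∫ x, (C c * X ^ k).eval x ∂ν), fun z hz => ?_⟩
    have h : C c * X ^ (k + 1) = X * (C c * X ^ k) := by ring
    rw [h, stieltjes_X_mul hν _ hz, eval_add, eval_mul, eval_mul, eval_X, eval_C, hq z hz]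
    ring

/-- If `p` is orthogonal to all polynomials of degree below that of `p`, then multiplication by
`p z` can be moved inside the Stieltjes transform of `p`. -/
lemma eval_mul_stieltjes_self (hν : ∀ᵐ x ∂ν, x ∈ Set.Icc (-1 : ℝ) 1) {p : ℝ[X]}
    (hp : ∀ r : ℝ[X], r.degree < p.degree → ∫ x, (r * p).eval x ∂ν = 0) {z : ℝ} (hz : 1 < z) :
    p.eval z * stieltjes ν p z = stieltjes ν (p * p) z := by
  obtain ⟨r, hr⟩ : X - C z ∣ p - C (p.eval z) := by
    rw [dvd_iff_isRoot]; simp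
  have hp' : p * p = (X - C z) * (r * p) + C (p.eval z) * p := by
    rw [← mul_assoc, ← hr]; ring
  have h0 : ∫ x, (r * p).eval x ∂ν = 0 := by
    rcases eq_or_ne r 0 with rfl | hr0
    · simp
    by_cases hd : 0 < p.degree
    · apply hp
      have h1 : p.degree = r.degree + 1 := by
        rw [← degree_sub_C hd (a := p.eval z), hr, degree_mul, degree_X_sub_C, add_comm]
      rw [h1, degree_eq_natDegree hr0]
      exact_mod_cast Nat.lt_succ_self _
    · exfalso
      rw [eq_C_of_degree_le_zero (not_lt.mp hd), eval_C, sub_self] at hr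
      exact mul_ne_zero (X_sub_C_ne_zero z) hr0 hr.symm
  conv_rhs => rw [hp']
  rw [stieltjes_add hν _ _ hz, stieltjes_X_sub_C_mul hν _ hz, h0, stieltjes_C_mul]
  ring

lemma tendsto_stieltjes_atTop (hν : ∀ᵐ x ∂ν, x ∈ Set.Icc (-1 : ℝ) 1) (p : ℝ[X]) :
    Filter.Tendsto (stieltjes ν p) Filter.atTop (nhds 0) := by
  have hlim : Filter.Tendsto (fun z : ℝ => (∫ x, |p.eval x| ∂ν) * (z - 1)⁻¹)
      Filter.atTop (nhds 0) := by
    have : Filter.Tendsto (fun z : ℝ => z - 1) Filter.atTop Filter.atTop :=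
      Filter.tendsto_atTop_add_const_right _ _ Filter.tendsto_id
    simpa using this.inv_tendsto_atTop.const_mul (∫ x, |p.eval x| ∂ν)
  refine squeeze_zero_norm' ?_ hlim
  filter_upwards [Filter.eventually_gt_atTop 1] with z hz
  rw [stieltjes, ← integral_mul_const]
  refine norm_integral_le_of_norm_le ((integrable_eval hν p).abs.mul_const _) ?_
  filter_upwards [hν] with x hx
  have hzx : 0 < z - x := by linarith [hx.2]
  rw [norm_mul, norm_inv, Real.norm_eq_abs, Real.norm_eq_abs, abs_of_pos hzx]
  gcongr
  exact hx.2

lemma tendsto_mul_stieltjes_atTop (hν : ∀ᵐ x ∂ν, x ∈ Set.Icc (-1 : ℝ) 1) (p : ℝ[X]) :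
    Filter.Tendsto (fun z => z * stieltjes ν p z) Filter.atTop (nhds (∫ x, p.eval x ∂ν)) := by
  have h := (tendsto_stieltjes_atTop hν (X * p)).add_const (∫ x, p.eval x ∂ν)
  rw [zero_add] at h
  refine h.congr' ?_
  filter_upwards [Filter.eventually_gt_atTop 1] with z hz
  rw [stieltjes_X_mul hν p hz]
  ring

lemma sq_relation_of_stieltjes_sq (hν : ∀ᵐ x ∂ν, x ∈ Set.Icc (-1 : ℝ) 1) {α β : ℝ}
    (hS : ∀ z, 1 < z → stieltjes ν 1 z ^ 2 * ((z ^ 2 - 1) * (z - β)) = z - α)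
    {p : ℝ[X]} (hdeg : 2 ≤ p.natDegree)
    (hp : ∀ r : ℝ[X], r.degree < p.degree → ∫ x, (r * p).eval x ∂ν = 0)
    {H B₁ B₂ : ℝ} (hH : ∫ x, (p * p).eval x ∂ν = H) (hB₁ : ∫ x, (X * (p * p)).eval x ∂ν = B₁)
    (hB₂ : ∫ x, (X * (X * (p * p))).eval x ∂ν = B₂) :
    H ^ 2 * (2 * B₁ - (α + β) * H) ^ 2 =
      4 * H ^ 2 * (2 * H * B₂ + B₁ ^ 2 - 2 * H * B₁ * (α + β) + H ^ 2 * (α * β - 1)) := by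
  obtain ⟨q, hq⟩ := exists_eval_eq_mul_stieltjes_sub hν p
  set S := stieltjes ν 1 with hSdef
  set R := stieltjes ν p with hRdef
  set G := stieltjes ν (p * p) with hGdef
  set e := stieltjes ν (X * (X * (X * (p * p)))) with hedef
  have hpR : ∀ z, 1 < z → p.eval z * R z = G z := fun z hz => eval_mul_stieltjes_self hν hp hz
  have he : ∀ z, 1 < z → z ^ 3 * G z = H * z ^ 2 + B₁ * z + B₂ + e z := fun z hz => by
    rw [hedef, stieltjes_X_mul hν _ hz, stieltjes_X_mul hν _ hz, stieltjes_X_mul hν _ hz, hH, hB₁,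
      hB₂]
    ring
  have hinv : Filter.Tendsto (fun z : ℝ => z⁻¹) Filter.atTop (nhds 0) := tendsto_inv_atTop_zero
  have tendsto_comp_inv : ∀ f : ℝ → ℝ, Continuous f →
      Filter.Tendsto (fun z : ℝ => f z⁻¹) Filter.atTop (nhds (f 0)) := fun f hf =>
    (hf.tendsto 0).comp hinv
  have hS0 : Filter.Tendsto S Filter.atTop (nhds 0) := tendsto_stieltjes_atTop hν 1
  have hR0 : Filter.Tendsto R Filter.atTop (nhds 0) := tendsto_stieltjes_atTop hν p
  have hG0 : Filter.Tendsto G Filter.atTop (nhds 0) := tendsto_stieltjes_atTop hν (p * p)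
  have he0 : Filter.Tendsto e Filter.atTop (nhds 0) := tendsto_stieltjes_atTop hν _
  have hR1 := tendsto_mul_stieltjes_atTop hν p
  have hG1 := tendsto_mul_stieltjes_atTop hν (p * p)
  have hW := tendsto_comp_inv (fun y => (1 - y ^ 2) * (1 - β * y)) (by fun_prop)
  -- `(z - α) p² - (z² - 1) (z - β) q²` has degree at most one
  set T : ℝ[X] := (X - C α) * p ^ 2 - (X ^ 2 - 1) * (X - C β) * q ^ 2 with hTdef
  have hT : ∀ z, 1 < z → T.eval z = (z ^ 2 - 1) * (z - β) * (2 * G z * S z - R z ^ 2) := by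
    intro z hz
    simp only [hTdef, eval_sub, eval_mul, eval_pow, eval_X, eval_C, eval_one, hq z hz]
    rw [← hS z hz, ← hpR z hz]
    ring
  have hTdeg : T.degree < (X ^ 2 : ℝ[X]).degree := by
    rw [← div_tendsto_atTop_zero_iff_degree_lt _ _ (by simp)]
    have h := hW.mul (((hG1.const_mul 2).mul hS0).sub (hR1.mul hR0))
    simp only [mul_zero, sub_zero] at h
    refine h.congr' ?_
    filter_upwards [Filter.eventually_gt_atTop 1] with z hz
    have : z ≠ 0 := by positivity
    rw [hT z hz, eval_pow, eval_X]
    field_simp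
    ring
  obtain ⟨c, d, hcd⟩ : ∃ c d, T = C c * X + C d := by
    refine exists_eq_X_add_C_of_natDegree_le_one ?_
    rcases eq_or_ne T 0 with h0 | h0
    · simp [h0]
    have h := natDegree_lt_natDegree h0 hTdeg
    rw [natDegree_X_pow] at h
    omega
  -- `R z` is `O(z⁻³)`
  have hp0 : p ≠ 0 := by rintro rfl; simp at hdeg
  obtain ⟨l, hl⟩ : ∃ l, Filter.Tendsto (fun z => (X ^ 2 : ℝ[X]).eval z / p.eval z)
      Filter.atTop (nhds l) := by
    have h2 : (X ^ 2 : ℝ[X]).degree ≤ p.degree := by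
      rw [degree_X_pow, degree_eq_natDegree hp0]
      exact_mod_cast hdeg
    rcases h2.lt_or_eq with h | h
    · exact ⟨_, div_tendsto_atTop_zero_of_degree_lt _ _ h⟩
    · exact ⟨_, div_tendsto_atTop_leadingCoeff_div_of_degree_eq _ _ h⟩
  have hR3 : Filter.Tendsto (fun z => z ^ 3 * R z) Filter.atTop (nhds (H * l)) := by
    rw [← hH]
    refine (hG1.mul hl).congr' ?_
    filter_upwards [Filter.eventually_gt_atTop 1, p.eventually_atTop_not_isRoot hp0] with z hz hz'
    rw [← hGdef, ← hpR z hz, eval_pow, eval_X]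
    have : p.eval z ≠ 0 := hz'
    field_simp
  have hsmall : Filter.Tendsto
      (fun z => 4 * G z ^ 2 * ((z ^ 2 - 1) * (z - β) * (z - α)) - T.eval z ^ 2)
      Filter.atTop (nhds 0) := by
    have h := (hW.pow 2).mul ((((hG0.const_mul 4).mul hS0).mul (hR3.pow 2)).sub
      ((hR3.pow 2).mul (hR0.pow 2)))
    simp only [mul_zero, zero_mul, sub_zero, ne_eq, OfNat.ofNat_ne_zero, not_false_eq_true,
      zero_pow] at h
    refine h.congr' ?_
    filter_upwards [Filter.eventually_gt_atTop 1] with z hz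
    have : z ≠ 0 := by positivity
    rw [hT z hz, ← hS z hz]
    field_simp
    ring
  set u₀ := 4 * (2 * H * B₂ + B₁ ^ 2 - 2 * H * B₁ * (α + β) + H ^ 2 * (α * β - 1)) with hu₀
  set u₁ := 4 * (2 * H * B₁ - (α + β) * H ^ 2) with hu₁
  set U : ℝ[X] := C (4 * H ^ 2) * X ^ 2 + C u₁ * X + C u₀ with hU
  have hUlim : Filter.Tendsto
      (fun z => U.eval z - 4 * G z ^ 2 * ((z ^ 2 - 1) * (z - β) * (z - α)))
      Filter.atTop (nhds 0) := by
    have h1 := (tendsto_comp_inv (fun y => (1 - y ^ 2) * (1 - β * y) * (1 - α * y))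
      (by fun_prop)).mul
      (((tendsto_comp_inv (fun y => 8 * (H + B₁ * y + B₂ * y ^ 2)) (by fun_prop)).mul he0).add
        ((tendsto_comp_inv (fun y => 4 * y ^ 2) (by fun_prop)).mul (he0.pow 2)))
    have h2 := tendsto_comp_inv (fun y =>
      4 * (2 * B₁ * B₂ - (B₁ ^ 2 + 2 * H * B₂) * (α + β) + 2 * H * B₁ * (α * β - 1)
        + H ^ 2 * (α + β)) * y
      + 4 * (B₂ ^ 2 - 2 * B₁ * B₂ * (α + β) + (B₁ ^ 2 + 2 * H * B₂) * (α * β - 1)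
        + 2 * H * B₁ * (α + β) - H ^ 2 * (α * β)) * y ^ 2
      + 4 * (-B₂ ^ 2 * (α + β) + 2 * B₁ * B₂ * (α * β - 1) + (B₁ ^ 2 + 2 * H * B₂) * (α + β)
        - 2 * H * B₁ * (α * β)) * y ^ 3
      + 4 * (B₂ ^ 2 * (α * β - 1) + 2 * B₁ * B₂ * (α + β)
        - (B₁ ^ 2 + 2 * H * B₂) * (α * β)) * y ^ 4
      + 4 * (B₂ ^ 2 * (α + β) - 2 * B₁ * B₂ * (α * β)) * y ^ 5
      - 4 * B₂ ^ 2 * (α * β) * y ^ 6) (by fun_prop)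
    have h := (h1.add h2).neg
    simp only [mul_zero, ne_eq, OfNat.ofNat_ne_zero, not_false_eq_true, zero_pow, add_zero,
      sub_zero, neg_zero] at h
    refine h.congr' ?_
    filter_upwards [Filter.eventually_gt_atTop 1] with z hz
    have hz0 : z ≠ 0 := by positivity
    have hG : G z = (H * z ^ 2 + B₁ * z + B₂ + e z) / z ^ 3 := by
      rw [← he z hz]; field_simp
    simp only [hG, hU, hu₀, hu₁, eval_add, eval_mul, eval_C, eval_pow, eval_X]
    field_simp
    ring
  have hUT : U = T ^ 2 := by
    have h := hUlim.add hsmall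
    simp only [sub_add_sub_cancel, add_zero] at h
    simp only [← eval_pow, ← eval_sub] at h
    exact sub_eq_zero.mp (leadingCoeff_eq_zero.mp ((tendsto_nhds_iff _).mp h).1)
  rw [hcd] at hUT
  have e0 := congrArg (eval 0) hUT
  have e1 := congrArg (eval 1) hUT
  have e2 := congrArg (eval (-1)) hUT
  simp only [hU, eval_add, eval_mul, eval_C, eval_pow, eval_X] at e0 e1 e2
  have hd : u₀ = d ^ 2 := by linarith
  have hcd : u₁ = 2 * c * d := by linarith
  have hc : 4 * H ^ 2 = c ^ 2 := by linarith
  have key : u₁ ^ 2 = 4 * (4 * H ^ 2) * u₀ := by rw [hd, hcd, hc]; ring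
  rw [hu₁, hu₀] at key
  linarith

lemma integral_eval_add (hν : ∀ᵐ x ∂ν, x ∈ Set.Icc (-1 : ℝ) 1) (p q : ℝ[X]) :
    ∫ x, (p + q).eval x ∂ν = ∫ x, p.eval x ∂ν + ∫ x, q.eval x ∂ν := by
  simp only [eval_add]
  exact integral_add (integrable_eval hν p) (integrable_eval hν q)

omit [IsFiniteMeasure ν] in
lemma integral_eval_C_mul (c : ℝ) (p : ℝ[X]) :
    ∫ x, (C c * p).eval x ∂ν = c * ∫ x, p.eval x ∂ν := by
  simp only [eval_mul, eval_C]
  exact integral_const_mul _ _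

lemma integral_mul_eq_zero_of_degree_lt (hν : ∀ᵐ x ∂ν, x ∈ Set.Icc (-1 : ℝ) 1)
    {P : ℕ → ℝ[X]} (hPmonic : ∀ n, (P n).Monic) (hPdeg : ∀ n, (P n).natDegree = n)
    (horth : ∀ n m, n ≠ m → ∫ x, (P n * P m).eval x ∂ν = 0) (n : ℕ) (r : ℝ[X])
    (hr : r.degree < n) : ∫ x, (r * P n).eval x ∂ν = 0 := by
  suffices H : ∀ k ≤ n, ∀ r : ℝ[X], r.degree < k → ∫ x, (r * P n).eval x ∂ν = 0 from
    H n le_rfl r hr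
  intro k
  induction k with
  | zero =>
    intro _ r hr
    have : r = 0 := by simpa using hr
    simp [this]
  | succ k ih =>
    intro hk r hr
    have hr' : (r - C (r.coeff k) * P k).degree < k := by
      rw [degree_lt_iff_coeff_zero] at hr ⊢
      intro j hj
      rcases hj.eq_or_lt with rfl | hj
      · have : (P k).coeff k = 1 := by
          have := hPmonic k
          rwa [Monic, leadingCoeff, hPdeg] at this
        simp [this]
      · have : (P k).coeff j = 0 := coeff_eq_zero_of_natDegree_lt (by rwa [hPdeg])
        simp [hr j hj, this]
    have h : r * P n = (r - C (r.coeff k) * P k) * P n + C (r.coeff k) * (P k * P n) := by ring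
    rw [h, integral_eval_add hν, integral_eval_C_mul, ih (by omega) _ hr',
      horth _ _ (by omega)]
    ring

lemma recurrence_of_stieltjes_sq (hν : ∀ᵐ x ∂ν, x ∈ Set.Icc (-1 : ℝ) 1) {α β : ℝ}
    (hS : ∀ z, 1 < z → stieltjes ν 1 z ^ 2 * ((z ^ 2 - 1) * (z - β)) = z - α)
    {P : ℕ → ℝ[X]} {h a b : ℕ → ℝ} (hPmonic : ∀ n, (P n).Monic)
    (hPdeg : ∀ n, (P n).natDegree = n) (hh : ∀ n, 0 < h n)
    (horth : ∀ n m, ∫ x, (P n * P m).eval x ∂ν = if n = m then h n else 0)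
    (hrec : ∀ n, 1 ≤ n → P (n + 1) = (X - C (b (n + 1))) * P n - C (a n) * P (n - 1))
    {n : ℕ} (hn : 3 ≤ n) :
    a n + a (n - 1) = 1 / 2 + (β - α) ^ 2 / 8 + ((α + β) / 2) * b n - b n ^ 2 := by
  obtain ⟨m, rfl⟩ : ∃ m, n = m + 2 := ⟨n - 2, by omega⟩
  have hX : ∀ k, X * P (k + 1) = P (k + 2) + (C (b (k + 2)) * P (k + 1) + C (a (k + 1)) * P k) := by
    intro k
    rw [hrec (k + 1) (by omega), Nat.add_sub_cancel]
    ring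
  -- the matrix entries of multiplication by `X`
  have hI : ∀ k j, ∫ x, (X * P (k + 1) * P j).eval x ∂ν = (if k + 2 = j then h (k + 2) else 0)
      + (b (k + 2) * (if k + 1 = j then h (k + 1) else 0)
        + a (k + 1) * (if k = j then h k else 0)) := by
    intro k j
    rw [hX, add_mul, add_mul, mul_assoc, mul_assoc, integral_eval_add hν, integral_eval_add hν,
      integral_eval_C_mul, integral_eval_C_mul, horth, horth, horth]
  have hah : ∀ k, h (k + 2) = a (k + 2) * h (k + 1) := by
    intro k
    have h1 := hI k (k + 2)
    have h2 := hI (k + 1) (k + 1)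
    rw [show X * P (k + 1 + 1) * P (k + 1) = X * P (k + 1) * P (k + 2) by ring] at h2
    simp at h1 h2
    linarith
  obtain ⟨m, rfl⟩ : ∃ k, m = k + 1 := ⟨m - 1, by omega⟩
  set p := P (m + 2) with hp
  have hH : ∫ x, (p * p).eval x ∂ν = h (m + 2) := by rw [hp, horth, if_pos rfl]
  have hB₁ : ∫ x, (X * (p * p)).eval x ∂ν = b (m + 3) * h (m + 2) := by
    rw [← mul_assoc, hp, hI (m + 1)]
    simp
  have hB₂ : ∫ x, (X * (X * (p * p))).eval x ∂ν =
      (a (m + 3) + b (m + 3) ^ 2 + a (m + 2)) * h (m + 2) := by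
    have e : X * (X * (p * p)) = X * p * P (m + 3) + (C (b (m + 3)) * (X * p * p)
        + C (a (m + 2)) * (X * p * P (m + 1))) := by
      rw [show X * (X * (p * p)) = X * p * (X * p) by ring]
      conv_lhs => arg 2; rw [hp, hX (m + 1)]
      rw [hp]
      ring
    rw [e, integral_eval_add hν, integral_eval_add hν, integral_eval_C_mul, integral_eval_C_mul,
      hp, hI (m + 1), hI (m + 1), hI (m + 1)]
    have h1 := hah (m + 1)
    have h2 := hah m
    simp
    rw [h1, h2]
    ring
  have hdeg : p.natDegree = m + 2 := hPdeg _
  have key := sq_relation_of_stieltjes_sq hν hS (p := p) (by omega) (fun r hr => by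
    rw [degree_eq_natDegree (hPmonic _).ne_zero, hdeg] at hr
    refine integral_mul_eq_zero_of_degree_lt hν hPmonic hPdeg (fun i j hij => ?_) _ r hr
    rw [horth, if_neg hij]) hH hB₁ hB₂
  have hpos := hh (m + 2)
  have h4 : h (m + 2) ^ 4 ≠ 0 := by positivity
  have : (2 * b (m + 3) - (α + β)) ^ 2 = 4 * (2 * (a (m + 3) + b (m + 3) ^ 2 + a (m + 2))
      + b (m + 3) ^ 2 - 2 * b (m + 3) * (α + β) + (α * β - 1)) := by
    refine mul_left_cancel₀ h4 ?_
    linear_combination key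
  rw [show m + 1 + 2 - 1 = m + 2 by omega, show m + 1 + 2 = m + 3 by omega]
  linarith

end Stieltjes

section BandWeight

open Set

lemma lintegral_ofReal_deriv {u v : ℝ} (huv : u ≤ v) {F F' : ℝ → ℝ}
    (hF : ContinuousOn F (Icc u v)) (hF' : ∀ x ∈ Ioo u v, HasDerivAt F (F' x) x)
    (hpos : ∀ x ∈ Ioo u v, 0 ≤ F' x) :
    ∫⁻ x in Ioo u v, ENNReal.ofReal (F' x) = ENNReal.ofReal (F v - F u) := by
  have hint : IntervalIntegrable F' volume u v := by
    apply intervalIntegral.intervalIntegrable_deriv_of_nonneg (g := F)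
    · rwa [uIcc_of_le huv]
    · rwa [min_eq_left huv, max_eq_right huv]
    · rwa [min_eq_left huv, max_eq_right huv]
  rw [← intervalIntegral.integral_eq_sub_of_hasDerivAt_of_le huv hF hF' hint,
    intervalIntegral.integral_of_le huv, integral_Ioc_eq_integral_Ioo,
    ofReal_integral_eq_lintegral_ofReal]
  · exact (intervalIntegrable_iff_integrableOn_Ioo_of_le huv).mp hint
  · exact (ae_restrict_iff' measurableSet_Ioo).mpr (Filter.Eventually.of_forall hpos)

/-- `π` times the weight, on `[-1, α] ∪ [β, 1]`. -/
noncomputable def bandWeight (α β x : ℝ) : ℝ := √((x - α) / ((1 - x ^ 2) * (x - β)))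

/-- The density of the holomorphic differential `dx / (2 y)` on the elliptic curve
`y ^ 2 = (1 - x ^ 2) (x - β) (x - s)`. -/
noncomputable def ellipticDensity (s β x : ℝ) : ℝ :=
  (2 * √((1 - x ^ 2) * (|x - β| * |x - s|)))⁻¹

lemma measurable_bandWeight (α β : ℝ) : Measurable (bandWeight α β) := by
  unfold bandWeight; fun_prop

lemma one_sub_sq_pos {x : ℝ} (h₁ : -1 < x) (h₂ : x < 1) : 0 < 1 - x ^ 2 := by nlinarith

lemma lintegral_ellipticDensity_eq {s β : ℝ} (hs : -1 < s) (hsβ : s < β) (hβ : β < 1) :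
    ∫⁻ x in Ioo (-1) s, ENNReal.ofReal (ellipticDensity s β x) =
      ∫⁻ x in Ioo β 1, ENNReal.ofReal (ellipticDensity s β x) := by
  have hs2 := one_sub_sq_pos hs (hsβ.trans hβ)
  have hβ2 := one_sub_sq_pos (hs.trans hsβ) hβ
  -- the Möbius involution exchanging `-1 ↔ 1` and `s ↔ β`
  set φ : ℝ → ℝ := fun x => (s + β - (1 + s * β) * x) / (1 + s * β - (s + β) * x) with hφ
  have hden : ∀ x, -1 < x → x < 1 → 0 < 1 + s * β - (s + β) * x := by
    intro x h1 h2
    nlinarith [mul_pos (mul_pos (sub_pos.2 (hsβ.trans hβ)) (sub_pos.2 hβ)) (neg_lt_iff_pos_add.1 h1),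
      mul_pos (mul_pos (neg_lt_iff_pos_add.1 hs) (neg_lt_iff_pos_add.1 (hs.trans hsβ)))
        (sub_pos.2 h2)]
  have h1 : ∀ x, -1 < x → x < 1 →
      1 - φ x = (1 - s) * (1 - β) * (1 + x) / (1 + s * β - (s + β) * x) := by
    intro x h1 h2
    have := (hden x h1 h2).ne'
    rw [hφ]; field_simp; ring
  have h2 : ∀ x, -1 < x → x < 1 →
      1 + φ x = (1 + s) * (1 + β) * (1 - x) / (1 + s * β - (s + β) * x) := by
    intro x h1 h2
    have := (hden x h1 h2).ne'
    rw [hφ]; field_simp; ring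
  have h3 : ∀ x, -1 < x → x < 1 →
      φ x - β = (1 - β ^ 2) * (s - x) / (1 + s * β - (s + β) * x) := by
    intro x h1 h2
    have := (hden x h1 h2).ne'
    rw [hφ]; field_simp; ring
  have h4 : ∀ x, -1 < x → x < 1 →
      φ x - s = (1 - s ^ 2) * (β - x) / (1 + s * β - (s + β) * x) := by
    intro x h1 h2
    have := (hden x h1 h2).ne'
    rw [hφ]; field_simp; ring
  have hφ1 : ∀ x, -1 < x → x < 1 → -1 < φ x ∧ φ x < 1 := by
    intro x hx1 hx2
    have e1 : 0 < 1 - φ x := by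
      rw [h1 x hx1 hx2]
      have := hden x hx1 hx2
      have a1 : 0 < 1 - s := by linarith
      have a2 : 0 < 1 - β := by linarith
      have a3 : 0 < 1 + x := by linarith
      positivity
    have e2 : 0 < 1 + φ x := by
      rw [h2 x hx1 hx2]
      have := hden x hx1 hx2
      have a1 : 0 < 1 + s := by linarith
      have a2 : 0 < 1 + β := by linarith
      have a3 : 0 < 1 - x := by linarith
      positivity
    constructor <;> linarith
  have hinv : ∀ x, -1 < x → x < 1 → φ (φ x) = x := by
    intro x hx1 hx2
    have d1 := (hden x hx1 hx2).ne'
    have d2 := (hden _ (hφ1 x hx1 hx2).1 (hφ1 x hx1 hx2).2).ne'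
    rw [hφ] at d2 ⊢
    have hD : (1 + s * β) * (1 + s * β - (s + β) * x) - (s + β) * (s + β - (1 + s * β) * x)
        = (1 - s ^ 2) * (1 - β ^ 2) := by ring
    have d3 : (1 + s * β) * (1 + s * β - (s + β) * x) - (s + β) * (s + β - (1 + s * β) * x)
        ≠ 0 := by rw [hD]; positivity
    simp only
    rw [div_eq_iff d2]
    field_simp
    ring
  have himage : φ '' Ioo (-1) s = Ioo β 1 := by
    ext y
    constructor
    · rintro ⟨x, hx, rfl⟩
      have hx2 : x < 1 := by linarith [hx.2]
      refine ⟨?_, (hφ1 x hx.1 hx2).2⟩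
      have := hden x hx.1 hx2
      have h : 0 < φ x - β := by
        rw [h3 x hx.1 hx2]
        have : 0 < s - x := by linarith [hx.2]
        positivity
      linarith
    · intro hy
      have hy1 : -1 < y := by linarith [hy.1]
      refine ⟨φ y, ⟨(hφ1 y hy1 hy.2).1, ?_⟩, hinv y hy1 hy.2⟩
      have := hden y hy1 hy.2
      have h : 0 < s - φ y := by
        rw [← neg_sub, h4 y hy1 hy.2, ← neg_div, ← mul_neg, neg_sub]
        have : 0 < y - β := by linarith [hy.1]
        positivity
      linarith
  have hderiv : ∀ x ∈ Ioo (-1) s, HasDerivWithinAt φ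
      (-((1 - s ^ 2) * (1 - β ^ 2) / (1 + s * β - (s + β) * x) ^ 2)) (Ioo (-1) s) x := by
    intro x hx
    have d1 := (hden x hx.1 (by linarith [hx.2])).ne'
    have := (((hasDerivAt_id x).const_mul (1 + s * β)).const_sub (s + β)).div
      (((hasDerivAt_id x).const_mul (s + β)).const_sub (1 + s * β)) d1
    refine (this.congr_deriv ?_).hasDerivWithinAt
    simp only [id]
    field_simp
    ring
  have hinj : InjOn φ (Ioo (-1) s) := by
    intro x hx y hy hxy
    rw [← hinv x hx.1 (by linarith [hx.2]), hxy, hinv y hy.1 (by linarith [hy.2])]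
  rw [← himage, lintegral_image_eq_lintegral_abs_deriv_mul measurableSet_Ioo hderiv hinj]
  refine setLIntegral_congr_fun measurableSet_Ioo fun x hx => ?_
  have hx2 : x < 1 := by linarith [hx.2]
  have d1 := hden x hx.1 hx2
  have hx3 := one_sub_sq_pos hx.1 hx2
  have hj : 0 < (1 - s ^ 2) * (1 - β ^ 2) / (1 + s * β - (s + β) * x) ^ 2 := by positivity
  rw [← ENNReal.ofReal_mul (abs_nonneg _), abs_neg, abs_of_pos hj]
  congr 1
  have hk : (1 - φ x ^ 2) * (|φ x - β| * |φ x - s|) =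
      ((1 - s ^ 2) * (1 - β ^ 2) / (1 + s * β - (s + β) * x) ^ 2) ^ 2 *
        ((1 - x ^ 2) * (|x - β| * |x - s|)) := by
    rw [h3 x hx.1 hx2, h4 x hx.1 hx2, show 1 - φ x ^ 2 = (1 - φ x) * (1 + φ x) by ring,
      h1 x hx.1 hx2, h2 x hx.1 hx2, abs_div, abs_div, abs_mul, abs_mul, abs_of_pos d1,
      abs_of_pos hs2, abs_of_pos hβ2, abs_sub_comm s x, abs_sub_comm β x]
    field_simp
    ring
  rw [ellipticDensity, ellipticDensity, hk, Real.sqrt_mul (sq_nonneg _), Real.sqrt_sq hj.le,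
    mul_left_comm 2, mul_inv (_ / _), mul_inv_cancel_left₀ hj.ne']

lemma lintegral_inv_sqrt_one_sub_sq {u v : ℝ} (hu : -1 ≤ u) (huv : u ≤ v) (hv : v ≤ 1) :
    ∫⁻ x in Ioo u v, ENNReal.ofReal (√(1 - x ^ 2))⁻¹ =
      ENNReal.ofReal (Real.arcsin v - Real.arcsin u) := by
  refine lintegral_ofReal_deriv huv Real.continuous_arcsin.continuousOn (fun x hx => ?_)
    fun x _ => by positivity
  have := Real.hasDerivAt_arcsin (x := x) (by linarith [hx.1]) (by linarith [hx.2])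
  rwa [one_div] at this

lemma bandWeight_left {α β x : ℝ} (hαβ : α < β) (hx1 : -1 < x) (hx : x ≤ α) (hβ : β < 1) :
    bandWeight α β x = (√((1 - x ^ 2) * (β - x)))⁻¹ * √(α - x) := by
  have h := one_sub_sq_pos hx1 (by linarith)
  have h' : 0 < β - x := by linarith
  rw [bandWeight, show (x - α) / ((1 - x ^ 2) * (x - β)) = (α - x) / ((1 - x ^ 2) * (β - x)) by
    rw [← neg_sub α, ← neg_sub β, mul_neg, neg_div_neg_eq],
    Real.sqrt_div' _ (by positivity), div_eq_inv_mul]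

lemma bandWeight_right {α β x : ℝ} (hαβ : α < β) (hα : -1 < α) (hx : β < x) (hx1 : x < 1) :
    bandWeight α β x = (√((1 - x ^ 2) * (x - β)))⁻¹ * √(x - α) := by
  have h := one_sub_sq_pos (by linarith) hx1
  have h' : 0 < x - β := by linarith
  rw [bandWeight, Real.sqrt_div' _ (by positivity), div_eq_inv_mul]

lemma ellipticDensity_eq_mul {s β x : ℝ} (hx1 : -1 < x) (hx2 : x < 1) :
    ellipticDensity s β x = (√((1 - x ^ 2) * |x - β|))⁻¹ * (1 / (2 * √|x - s|)) := by
  have h := one_sub_sq_pos hx1 hx2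
  rw [ellipticDensity, ← mul_assoc, Real.sqrt_mul (by positivity)]
  simp only [mul_inv, one_div]
  ring

/-- On the left of `β`, the arcsine density is the band weight plus an average of elliptic
densities. -/
lemma bandWeight_left_add_lintegral {α β x : ℝ} (hαβ : α < β) (hx1 : -1 < x)
    (hx : x < β) (hβ : β < 1) :
    ENNReal.ofReal ((√((1 - x ^ 2) * (β - x)))⁻¹ * √(α - x)) +
      ∫⁻ s in Ioi x ∩ Ioo α β, ENNReal.ofReal (ellipticDensity s β x) =
      ENNReal.ofReal (√(1 - x ^ 2))⁻¹ := by
  have h := one_sub_sq_pos hx1 (by linarith)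
  have h' : 0 < β - x := by linarith
  have hset : Ioi x ∩ Ioo α β = Ioo (max x α) β := by
    ext s; simp [and_assoc]
  have hmax : √(max x α - x) = √(α - x) := by
    rcases le_total x α with hxα | hxα
    · rw [max_eq_right hxα]
    · rw [max_eq_left hxα, sub_self, Real.sqrt_zero, Real.sqrt_eq_zero_of_nonpos (by linarith)]
  rw [hset, setLIntegral_congr_fun (g := fun s => ENNReal.ofReal
    ((√((1 - x ^ 2) * (β - x)))⁻¹ * (1 / (2 * √(s - x))))) measurableSet_Ioo,
    lintegral_ofReal_deriv (F := fun s => (√((1 - x ^ 2) * (β - x)))⁻¹ * √(s - x))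
      (F' := fun s => (√((1 - x ^ 2) * (β - x)))⁻¹ * (1 / (2 * √(s - x)))),
    ← ENNReal.ofReal_add (by positivity)]
  · congr 1
    rw [hmax, Real.sqrt_mul h.le]
    have : √(β - x) ≠ 0 := (Real.sqrt_pos.2 h').ne'
    field_simp
    ring
  · rw [← mul_sub]
    refine mul_nonneg (by positivity) (sub_nonneg.2 (Real.sqrt_le_sqrt ?_))
    exact sub_le_sub_right (max_le hx.le hαβ.le) _
  · exact max_le hx.le hαβ.le
  · fun_prop
  · intro s hs
    have : x < s := (le_max_left _ _).trans_lt hs.1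
    exact (((hasDerivAt_id s).sub_const x).sqrt (sub_pos.2 this).ne').const_mul _
  · intro s _
    positivity
  · intro s hs
    have : x < s := (le_max_left _ _).trans_lt hs.1
    simp only
    rw [ellipticDensity_eq_mul hx1 (by linarith), abs_sub_comm x β, abs_sub_comm x s,
      abs_of_pos h', abs_of_pos (sub_pos.2 this)]

/-- On the right of `β`, the band weight is the arcsine density plus an average of elliptic
densities. -/
lemma bandWeight_right_eq_add_lintegral {α β x : ℝ} (hα : -1 < α) (hαβ : α < β)
    (hx : β < x) (hx1 : x < 1) :
    ENNReal.ofReal (bandWeight α β x) = ENNReal.ofReal (√(1 - x ^ 2))⁻¹ +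
      ∫⁻ s in Ioo α β, ENNReal.ofReal (ellipticDensity s β x) := by
  have hx0 : -1 < x := by linarith
  have h := one_sub_sq_pos hx0 hx1
  have h' : 0 < x - β := by linarith
  rw [bandWeight_right hαβ hα hx hx1, setLIntegral_congr_fun (g := fun s => ENNReal.ofReal
    ((√((1 - x ^ 2) * (x - β)))⁻¹ * (1 / (2 * √(x - s))))) measurableSet_Ioo,
    lintegral_ofReal_deriv (F := fun s => -((√((1 - x ^ 2) * (x - β)))⁻¹ * √(x - s)))
      (F' := fun s => (√((1 - x ^ 2) * (x - β)))⁻¹ * (1 / (2 * √(x - s)))),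
    ← ENNReal.ofReal_add (by positivity)]
  · congr 1
    rw [Real.sqrt_mul h.le]
    have : √(x - β) ≠ 0 := (Real.sqrt_pos.2 h').ne'
    field_simp
    ring
  · rw [neg_sub_neg, ← mul_sub]
    refine mul_nonneg (by positivity) (sub_nonneg.2 (Real.sqrt_le_sqrt ?_))
    linarith
  · exact hαβ.le
  · fun_prop
  · intro s hs
    have : s < x := hs.2.trans hx
    have := ((((hasDerivAt_id s).const_sub x).sqrt (sub_pos.2 this).ne').const_mul
      (√((1 - x ^ 2) * (x - β)))⁻¹).neg
    refine this.congr_deriv ?_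
    simp only [id]
    ring
  · intro s _
    positivity
  · intro s hs
    have : s < x := hs.2.trans hx
    simp only
    rw [ellipticDensity_eq_mul hx0 hx1, abs_of_pos h', abs_of_pos (sub_pos.2 this)]

lemma measurable_uncurry_ellipticDensity (β : ℝ) :
    Measurable fun q : ℝ × ℝ => ENNReal.ofReal (ellipticDensity q.2 β q.1) := by
  unfold ellipticDensity; fun_prop

/-- The total mass of the band weight does not depend on `α` and `β`. -/
lemma lintegral_bandWeight {α β : ℝ} (hα : -1 < α) (hαβ : α < β) (hβ : β < 1) :
    (∫⁻ x in Ioo (-1) α, ENNReal.ofReal (bandWeight α β x)) +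
      (∫⁻ x in Ioo β 1, ENNReal.ofReal (bandWeight α β x)) = ENNReal.ofReal Real.pi := by
  set ρ : ℝ → ENNReal := fun x => ENNReal.ofReal ((√((1 - x ^ 2) * (β - x)))⁻¹ * √(α - x)) with hρ
  set f : ℝ → ℝ → ENNReal := fun x s => ENNReal.ofReal (ellipticDensity s β x) with hf
  have hfm : Measurable (Function.uncurry f) := measurable_uncurry_ellipticDensity β
  set Y := ∫⁻ s in Ioo α β, ∫⁻ x in Ioo β 1, f x s with hY
  have hleft0 : ∫⁻ x in Ioo (-1) α, ENNReal.ofReal (bandWeight α β x) =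
      ∫⁻ x in Ioo (-1) β, ρ x := by
    rw [← Ioo_union_Ico_eq_Ioo hα hαβ.le, lintegral_union measurableSet_Ico,
      setLIntegral_congr_fun (s := Ico α β) (g := fun _ => 0) measurableSet_Ico, lintegral_zero,
      add_zero]
    · refine setLIntegral_congr_fun measurableSet_Ioo fun x hx => ?_
      simp only [hρ]
      rw [bandWeight_left hαβ hx.1 hx.2.le hβ]
    · intro x hx
      simp only [hρ]
      rw [Real.sqrt_eq_zero_of_nonpos (sub_nonpos.2 hx.1), mul_zero, ENNReal.ofReal_zero]
    · rw [Set.disjoint_left]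
      intro x hx hx'
      linarith [hx.2, hx'.1]
  have hleft : (∫⁻ x in Ioo (-1) β, ρ x) + Y =
      ENNReal.ofReal (Real.arcsin β - Real.arcsin (-1)) := by
    rw [← lintegral_inv_sqrt_one_sub_sq le_rfl (hα.trans hαβ).le hβ.le]
    have hswap : Y = ∫⁻ x in Ioo (-1) β, ∫⁻ s in Ioi x ∩ Ioo α β, f x s := by
      have h1 : ∀ x, ∫⁻ s in Ioi x ∩ Ioo α β, f x s =
          ∫⁻ s in Ioo α β, {q : ℝ × ℝ | q.1 < q.2}.indicator (Function.uncurry f) (x, s) :=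
        fun x => by rw [← setLIntegral_indicator measurableSet_Ioi]; rfl
      simp only [h1]
      rw [lintegral_lintegral_swap, hY]
      · refine setLIntegral_congr_fun measurableSet_Ioo fun s hs => ?_
        have h2 : ∫⁻ x in Ioo (-1) β, {q : ℝ × ℝ | q.1 < q.2}.indicator (Function.uncurry f) (x, s)
            = ∫⁻ x in Iio s ∩ Ioo (-1) β, f x s := by
          rw [← setLIntegral_indicator measurableSet_Iio]; rfl
        have h3 : Iio s ∩ Ioo (-1) β = Ioo (-1) s := by
          ext x
          simp only [mem_inter_iff, mem_Iio, mem_Ioo]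
          constructor
          · rintro ⟨h, h', _⟩; exact ⟨h', h⟩
          · rintro ⟨h, h'⟩; exact ⟨h', h, h'.trans hs.2⟩
        simp only [h2, h3]
        exact (lintegral_ellipticDensity_eq (hα.trans hs.1) hs.2 hβ).symm
      · exact (hfm.indicator (measurableSet_lt measurable_fst measurable_snd)).aemeasurable
    rw [hswap, ← lintegral_add_left (by rw [hρ]; fun_prop)]
    refine setLIntegral_congr_fun measurableSet_Ioo fun x hx => ?_
    exact bandWeight_left_add_lintegral hαβ hx.1 hx.2 hβ
  have hright : ∫⁻ x in Ioo β 1, ENNReal.ofReal (bandWeight α β x) =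
      ENNReal.ofReal (Real.arcsin 1 - Real.arcsin β) + Y := by
    rw [← lintegral_inv_sqrt_one_sub_sq (hα.trans hαβ).le hβ.le le_rfl, hY,
      lintegral_lintegral_swap, ← lintegral_add_left (by fun_prop)]
    · refine setLIntegral_congr_fun measurableSet_Ioo fun x hx => ?_
      exact bandWeight_right_eq_add_lintegral hα hαβ hx.1 hx.2
    · exact (hfm.comp measurable_swap).aemeasurable
  rw [hleft0, hright, add_left_comm, hleft, ← ENNReal.ofReal_add]
  · simp only [Real.arcsin_one, Real.arcsin_neg_one]
    congr 1
    ring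
  · exact sub_nonneg.2 (Real.arcsin_le_arcsin hβ.le)
  · exact sub_nonneg.2 (Real.arcsin_le_arcsin (hα.trans hαβ).le)

lemma setLIntegral_bandWeight_moebius {α β z : ℝ} (hα : -1 < α) (hαβ : α < β) (hβ : β < 1)
    (hz : 1 < z) {u v : ℝ} (hu : -1 ≤ u) (huv : u < v) (hv : v ≤ 1)
    (hβ' : β ∉ Ioo u v) :
    ∫⁻ x in Ioo ((z * u - 1) / (z - u)) ((z * v - 1) / (z - v)),
        ENNReal.ofReal (bandWeight ((z * α - 1) / (z - α)) ((z * β - 1) / (z - β)) x) =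
      ENNReal.ofReal √((z - β) * (z ^ 2 - 1) / (z - α)) *
        ∫⁻ x in Ioo u v, ENNReal.ofReal (bandWeight α β x * (z - x)⁻¹) := by
  set ψ : ℝ → ℝ := fun x => (z * x - 1) / (z - x) with hψ
  have hz2 : 0 < z ^ 2 - 1 := by nlinarith
  have hsub : ∀ x y, x < z → y < z →
      ψ x - ψ y = (z ^ 2 - 1) * (x - y) / ((z - x) * (z - y)) := by
    intro x y hx hy
    have h1 := (sub_pos.2 hx).ne'
    have h2 := (sub_pos.2 hy).ne'
    simp only [hψ]; field_simp; ring
  have hmono : ∀ x y, x < z → y < z → x < y → ψ x < ψ y := by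
    intro x y hx hy hxy
    rw [← sub_pos, hsub y x hy hx]
    have h1 := sub_pos.2 hx
    have h2 := sub_pos.2 hy
    have h3 := sub_pos.2 hxy
    positivity
  have himage : ψ '' Ioo u v = Ioo (ψ u) (ψ v) := by
    ext y
    constructor
    · rintro ⟨x, hx, rfl⟩
      exact ⟨hmono _ _ (by linarith) (by linarith [hx.2]) hx.1,
        hmono _ _ (by linarith [hx.2]) (by linarith) hx.2⟩
    · intro hy
      have hu1 : -1 ≤ ψ u := by
        simp only [hψ]
        rw [le_div_iff₀ (by linarith)]
        nlinarith
      have hzy : 0 < z + y := by linarith [hy.1]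
      have hyz : (z * y + 1) / (z + y) < z := by
        rw [div_lt_iff₀ hzy]; nlinarith
      have hψy : ψ ((z * y + 1) / (z + y)) = y := by
        have h1 := (sub_pos.2 hyz).ne'
        simp only [hψ]
        rw [div_eq_iff h1]
        field_simp
        ring
      refine ⟨(z * y + 1) / (z + y), ⟨?_, ?_⟩, hψy⟩
      · by_contra! h
        rcases h.lt_or_eq with h | h
        · have := hmono _ _ hyz (by linarith) h
          rw [hψy] at this
          linarith [hy.1]
        · rw [← h, hψy] at hy
          exact lt_irrefl _ hy.1
      · by_contra! h
        rcases h.lt_or_eq with h | h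
        · have := hmono _ _ (by linarith) hyz h
          rw [hψy] at this
          linarith [hy.2]
        · rw [h, hψy] at hy
          exact lt_irrefl _ hy.2
  have hderiv : ∀ x ∈ Ioo u v, HasDerivWithinAt ψ ((z ^ 2 - 1) / (z - x) ^ 2) (Ioo u v) x := by
    intro x hx
    have d1 : z - x ≠ 0 := by linarith [hx.2]
    have := (((hasDerivAt_id x).const_mul z).sub_const 1).div ((hasDerivAt_id x).const_sub z) d1
    refine (this.congr_deriv ?_).hasDerivWithinAt
    simp only [id]
    field_simp
    ring
  have hinj : InjOn ψ (Ioo u v) := StrictMonoOn.injOn fun x hx y hy hxy =>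
    hmono x y (by linarith [hx.2]) (by linarith [hy.2]) hxy
  change ∫⁻ x in Ioo (ψ u) (ψ v), ENNReal.ofReal (bandWeight (ψ α) (ψ β) x) = _
  rw [← himage, lintegral_image_eq_lintegral_abs_deriv_mul measurableSet_Ioo hderiv hinj,
    ← lintegral_const_mul' _ _ ENNReal.ofReal_ne_top]
  refine setLIntegral_congr_fun measurableSet_Ioo fun x hx => ?_
  have hxβ : x - β ≠ 0 := by
    rintro h
    exact hβ' (by rwa [← sub_eq_zero.1 h])
  have hzα : 0 < z - α := by linarith
  have hzβ : 0 < z - β := by linarith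
  have hzx : 0 < z - x := by linarith [hx.2]
  have hx2 := one_sub_sq_pos (hu.trans_lt hx.1) (hx.2.trans_le hv)
  have e1 : (ψ x - ψ α) / ((1 - ψ x ^ 2) * (ψ x - ψ β)) =
      ((z - β) * (z ^ 2 - 1) / (z - α)) * ((z - x) / (z ^ 2 - 1)) ^ 2 *
        ((x - α) / ((1 - x ^ 2) * (x - β))) := by
    have e2 : 1 - ψ x ^ 2 = (z ^ 2 - 1) * (1 - x ^ 2) / (z - x) ^ 2 := by
      simp only [hψ]; field_simp; ring
    rw [hsub x α (by linarith) (by linarith), hsub x β (by linarith) (by linarith), e2]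
    field_simp
  rw [← ENNReal.ofReal_mul (abs_nonneg _), ← ENNReal.ofReal_mul (by positivity),
    abs_of_pos (by positivity), bandWeight, bandWeight, e1,
    Real.sqrt_mul (by positivity), Real.sqrt_mul (by positivity), Real.sqrt_sq (by positivity)]
  congr 1
  field_simp

lemma lintegral_bandWeight_mul_inv_sub {α β z : ℝ} (hα : -1 < α) (hαβ : α < β) (hβ : β < 1)
    (hz : 1 < z) :
    ENNReal.ofReal √((z - β) * (z ^ 2 - 1) / (z - α)) *
      ∫⁻ x in Icc (-1) α ∪ Icc β 1, ENNReal.ofReal (bandWeight α β x * (z - x)⁻¹) =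
    ENNReal.ofReal Real.pi := by
  have hdisj : Disjoint (Icc (-1) α) (Icc β 1) := by
    rw [Set.disjoint_left]
    intro x hx hx'
    linarith [hx.2, hx'.1]
  rw [lintegral_union measurableSet_Icc hdisj, mul_add,
    setLIntegral_congr (Ioo_ae_eq_Icc (a := -1) (b := α)).symm,
    setLIntegral_congr (Ioo_ae_eq_Icc (a := β) (b := 1)).symm,
    ← setLIntegral_bandWeight_moebius hα hαβ hβ hz le_rfl hα (by linarith)
      (fun h => by linarith [h.2]),
    ← setLIntegral_bandWeight_moebius hα hαβ hβ hz (by linarith) hβ le_rfl (by simp)]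
  have h1 : (z * -1 - 1) / (z - -1) = -1 := by
    rw [div_eq_iff (by linarith)]; ring
  have h2 : (z * 1 - 1) / (z - 1) = 1 := by
    rw [div_eq_iff (by linarith)]; ring
  rw [h1, h2]
  apply lintegral_bandWeight
  · rw [lt_div_iff₀ (by linarith)]; nlinarith
  · rw [div_lt_div_iff₀ (by linarith) (by linarith)]
    have hz2 : 0 < z ^ 2 - 1 := by nlinarith
    nlinarith [mul_pos hz2 (sub_pos.2 hαβ)]
  · rw [div_lt_iff₀ (by linarith)]; nlinarith

/-- The Stieltjes transform of the band weight is the square root of a rational function. -/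
lemma sq_integral_bandWeight_mul_inv_sub {α β z : ℝ} (hα : -1 < α) (hαβ : α < β) (hβ : β < 1)
    (hz : 1 < z) :
    (∫ x in Icc (-1) α ∪ Icc β 1, bandWeight α β x * (z - x)⁻¹) ^ 2 *
      ((z ^ 2 - 1) * (z - β)) = Real.pi ^ 2 * (z - α) := by
  have h := congrArg ENNReal.toReal (lintegral_bandWeight_mul_inv_sub hα hαβ hβ hz)
  have hzα : 0 < z - α := by linarith
  have hzβ : 0 < z - β := by linarith
  have hz2 : 0 < z ^ 2 - 1 := by nlinarith
  rw [ENNReal.toReal_mul, ENNReal.toReal_ofReal (by positivity),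
    ENNReal.toReal_ofReal Real.pi_pos.le, ← integral_eq_lintegral_of_nonneg_ae] at h
  · rw [← h, mul_pow, Real.sq_sqrt (by positivity)]
    field_simp
  · refine (ae_restrict_iff' (measurableSet_Icc.union measurableSet_Icc)).mpr
      (Filter.Eventually.of_forall fun x hx => mul_nonneg (Real.sqrt_nonneg _) (inv_nonneg.2 ?_))
    rcases hx with hx | hx <;> linarith [hx.2]
  · have := measurable_bandWeight α β
    exact Measurable.aestronglyMeasurable (by fun_prop)

end BandWeight

/-- second non-linear difference equation for the recurrence coefficients. -/
theorem recurrence_difference_two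
    (α β : ℝ) (hα : (-1:ℝ) < α) (hαβ : α < β) (hβ : β < 1)
    (E : Set ℝ) (hE : E = Set.Icc (-1) α ∪ Set.Icc β 1)
    (w : ℝ → ℝ)
    (hw : ∀ x, w x = (1 / Real.pi) * Real.sqrt ((x - α) / ((1 - x ^ 2) * (x - β))))
    (hw0 : ∀ x ∈ E, 0 ≤ w x)
    (hwint : MeasureTheory.IntegrableOn w E)
    (P : ℕ → Polynomial ℝ) (h : ℕ → ℝ) (a b : ℕ → ℝ)
    (hPmonic : ∀ n, (P n).Monic)
    (hPdeg : ∀ n, (P n).natDegree = n)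
    (hh : ∀ n, 0 < h n)
    (horth : ∀ n m, ∫ x in E, (P n).eval x * (P m).eval x * w x = if n = m then h n else 0)
    (ha : ∀ n, 1 ≤ n → 0 < a n)
    (hrec0 : P 1 = (Polynomial.X - Polynomial.C (b 1)) * P 0)
    (hrec : ∀ n, 1 ≤ n →
      P (n + 1) = (Polynomial.X - Polynomial.C (b (n + 1))) * P n - Polynomial.C (a n) * P (n - 1))
    (n : ℕ) (hn : 3 ≤ n) :
    a n + a (n - 1) = 1 / 2 + (β - α) ^ 2 / 8 + ((α + β) / 2) * b n - b n ^ 2 := by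
  have hwband : ∀ x, w x = Real.pi⁻¹ * bandWeight α β x := fun x => by
    rw [hw, bandWeight, one_div]
  have hwm : Measurable w := by
    rw [funext hwband]
    exact (measurable_bandWeight α β).const_mul _
  have hEm : MeasurableSet E := by
    rw [hE]
    exact measurableSet_Icc.union measurableSet_Icc
  have hw0' : ∀ᵐ x ∂volume.restrict E, 0 ≤ w x :=
    (ae_restrict_iff' hEm).mpr (Filter.Eventually.of_forall hw0)
  set ν : Measure ℝ := (volume.restrict E).withDensity fun x => ENNReal.ofReal (w x) with hνdef
  have : IsFiniteMeasure ν := isFiniteMeasure_withDensity_ofReal hwint.2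
  have hν : ∀ᵐ x ∂ν, x ∈ Set.Icc (-1 : ℝ) 1 := by
    refine (withDensity_absolutelyContinuous _ _).ae_le ?_
    refine (ae_restrict_iff' hEm).mpr (Filter.Eventually.of_forall fun x hx => ?_)
    rw [hE] at hx
    rcases hx with hx | hx
    · exact ⟨hx.1, by linarith [hx.2]⟩
    · exact ⟨by linarith [hx.1], hx.2⟩
  have hint : ∀ f : ℝ → ℝ, ∫ x, f x ∂ν = ∫ x in E, w x * f x := by
    intro f
    rw [hνdef, integral_withDensity_eq_integral_toReal_smul hwm.ennreal_ofReal
      (Filter.Eventually.of_forall fun _ => ENNReal.ofReal_lt_top)]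
    refine integral_congr_ae ?_
    filter_upwards [hw0'] with x hx
    rw [ENNReal.toReal_ofReal hx, smul_eq_mul]
  refine recurrence_of_stieltjes_sq (ν := ν) hν (fun z hz => ?_) hPmonic hPdeg hh
    (fun n m => ?_) hrec hn
  · have h1 : stieltjes ν 1 z =
        Real.pi⁻¹ * ∫ x in Set.Icc (-1) α ∪ Set.Icc β 1, bandWeight α β x * (z - x)⁻¹ := by
      rw [stieltjes, hint, hE, ← integral_const_mul]
      simp only [hwband, eval_one, one_mul, mul_assoc]
    rw [h1, mul_pow, mul_assoc, sq_integral_bandWeight_mul_inv_sub hα hαβ hβ hz]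
    have := Real.pi_ne_zero
    field_simp
  · rw [← horth n m, hint]
    simp only [eval_mul, mul_comm]
end
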